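/- Let G be the m × n rectangular grid graph with N = mn vertices (unit vertex weights) and suppose G admits at least one partition of V(G) into connected parts of size 3 (a triomino tiling), so that 3 divides N and k = N/3. Then: (1) any two triomino tilings of G are connected by a sequence of at most 10N BUD steps on partitions; and (2) any two spanning trees in B^0_{N/3}(G) are connected by a sequence of at most (61/3)·N up–down edge-exchange steps (each adding one edge of G and removing one edge of the created cycle) all of whose intermediate trees lie in B^0_{N/3}(G). -/

import Mathlib

open SimpleGraph

/-- The total weight of a connected component of a graph. -/
noncomputable def compWeight {V : Type*} (G : SimpleGraph V) (p : V → ℝ)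
    (c : G.ConnectedComponent) : ℝ :=
  ∑ᶠ v ∈ c.supp, p v

/-- `S` is a set of `k - 1` edges of `T` whose removal partitions the vertex set
into `k` connected components, each of total weight within `ε/2` of `p(G)/k`. -/
def IsBalancedCutSet {V : Type*} (T : SimpleGraph V) (p : V → ℝ) (k : ℕ) (ε : ℝ)
    (S : Finset (Sym2 V)) : Prop :=
  (S : Set (Sym2 V)) ⊆ T.edgeSet ∧ S.card = k - 1 ∧
    Nat.card (T.deleteEdges (S : Set (Sym2 V))).ConnectedComponent = k ∧
    ∀ c : (T.deleteEdges (S : Set (Sym2 V))).ConnectedComponent,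
      compWeight _ p c ∈
        Set.Icc ((∑ᶠ v, p v) / k - ε / 2) ((∑ᶠ v, p v) / k + ε / 2)

/-- `T ∈ B^ε_k(G)`: `T` is an `ε`-balanced `k`-splittable spanning tree of `G`. -/
def MemB {V : Type*} (G : SimpleGraph V) (p : V → ℝ) (k : ℕ) (ε : ℝ)
    (T : SimpleGraph V) : Prop :=
  T ≤ G ∧ T.IsTree ∧ ∃ S : Finset (Sym2 V), IsBalancedCutSet T p k ε S

/-- A step of the BUD walk on `B^ε_k(G)`: add an edge `e` of `G` not in `T`,
then remove an edge `f` of the resulting unique cycle (equivalently, an edge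
whose removal leaves a tree), such that the result is again in `B^ε_k(G)`. -/
def BUDStep {V : Type*} (G : SimpleGraph V) (p : V → ℝ) (k : ℕ) (ε : ℝ)
    (T T' : SimpleGraph V) : Prop :=
  MemB G p k ε T ∧ MemB G p k ε T' ∧
  ∃ e ∈ G.edgeSet \ T.edgeSet, ∃ f ∈ (T ⊔ SimpleGraph.fromEdgeSet {e}).edgeSet,
    T' = (T ⊔ SimpleGraph.fromEdgeSet {e}).deleteEdges {f}

/-- `P : V → Fin k` is a 0-balanced `k`-partition of `G`: each part induces a
connected subgraph of total weight exactly `p(G)/k`. -/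
def IsBalancedPartition {V : Type*} (G : SimpleGraph V) (p : V → ℝ) (k : ℕ)
    (P : V → Fin k) : Prop :=
  (∀ i : Fin k, (G.induce (P ⁻¹' {i})).Connected) ∧
  (∀ i : Fin k, ∑ᶠ v ∈ P ⁻¹' {i}, p v = (∑ᶠ v, p v) / k)

/-- A BUD step on partitions: `Q` is obtained from `P` via a cycle of `ℓ`
distinct parts (`2 ≤ ℓ ≤ k`) in the quotient multigraph `G/P` and nonempty
subgraphs `H i ⊆ P i` (with `H i` and `P i \ H i` connected), by transferring
each `H i` from part `i` to part `i + 1` cyclically. -/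
def PartitionBUDStep {V : Type*} (G : SimpleGraph V) (k : ℕ)
    (P Q : V → Fin k) : Prop :=
  ∃ l : ℕ, l + 2 ≤ k ∧ ∃ σ : Fin (l + 2) → Fin k, Function.Injective σ ∧
    ∃ H : Fin (l + 2) → Set V,
      (∀ i, (H i).Nonempty) ∧
      (∀ i, H i ⊆ P ⁻¹' {σ i}) ∧
      (∀ i, (G.induce (H i)).Connected) ∧
      (∀ i, (G.induce (P ⁻¹' {σ i} \ H i)).Connected) ∧
      (∀ i, ∃ u ∈ P ⁻¹' {σ i}, ∃ x ∈ P ⁻¹' {σ (i + 1)}, G.Adj u x) ∧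
      (∀ i : Fin (l + 2), ((P ⁻¹' {σ (i + 1)} \ H (i + 1)) ∪ H i) ∈
        Set.range (fun j : Fin k => Q ⁻¹' {j})) ∧
      (∀ j : Fin k, j ∉ Set.range σ →
        P ⁻¹' {j} ∈ Set.range (fun j' : Fin k => Q ⁻¹' {j'}))

/-- The `m × n` rectangular grid graph. -/
def rectGrid (m n : ℕ) : SimpleGraph (Fin m × Fin n) :=
  SimpleGraph.fromRel (fun u v =>
    ((u.1 : ℤ) - (v.1 : ℤ)) ^ 2 + ((u.2 : ℤ) - (v.2 : ℤ)) ^ 2 = 1)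

/-! ### Tilings and elementary moves -/

/-- Every part is a path on three vertices. -/
def Good {V : Type*} (G : SimpleGraph V) {k : ℕ} (P : V → Fin k) : Prop :=
  ∀ i, ∃ a b c, a ≠ c ∧ G.Adj a b ∧ G.Adj b c ∧ ∀ u, P u = i ↔ u = a ∨ u = b ∨ u = c

/-- Cyclic transfer of single cells. -/
def Move {V : Type*} (G : SimpleGraph V) {k : ℕ} (P Q : V → Fin k) (l : ℕ) : Prop :=
  ∃ v b c : Fin (l + 2) → V, Function.Injective (fun i => P (v i)) ∧
    (∀ i, Q (v i) = P (v (i + 1))) ∧ (∀ u, (∀ i, u ≠ v i) → Q u = P u) ∧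
    (∀ i u, P u = P (v (i + 1)) ↔ u = v (i + 1) ∨ u = b i ∨ u = c i) ∧
    (∀ i, b i ≠ v (i + 1) ∧ c i ≠ v (i + 1)) ∧
    (∀ i, G.Adj (b i) (c i)) ∧ (∀ i, G.Adj (v i) (b i))

/-- Reachability by moves with total cost. -/
inductive Reach {V : Type*} (G : SimpleGraph V) {k : ℕ} : ℕ → (V → Fin k) → (V → Fin k) → Prop
  | refl (P) : Reach G 0 P P
  | step {P Q R : V → Fin k} {l c : ℕ} : Good G P → Good G Q → Move G P Q l → Reach G c Q R →
      Reach G (l + 2 + c) P R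

theorem Reach.trans {V : Type*} {G : SimpleGraph V} {k : ℕ} {P Q R : V → Fin k} {c d : ℕ}
    (h : Reach G c P Q) (h' : Reach G d Q R) : Reach G (c + d) P R := by
  induction h with
  | refl P => simpa using h'
  | step a b m _ ih => rw [add_assoc]; exact Reach.step a b m (ih h')

/-- The fibre of the new partition. -/
theorem move_fiber {V : Type*} {k l : ℕ} {P Q : V → Fin k}
    {v b c : Fin (l + 2) → V} (hinj : Function.Injective (fun i => P (v i)))
    (hQ : ∀ i, Q (v i) = P (v (i + 1))) (hQ' : ∀ u, (∀ i, u ≠ v i) → Q u = P u)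
    (hf : ∀ i u, P u = P (v (i + 1)) ↔ u = v (i + 1) ∨ u = b i ∨ u = c i)
    (hne : ∀ i, b i ≠ v (i + 1) ∧ c i ≠ v (i + 1)) (i : Fin (l + 2)) (u : V) :
    Q u = P (v (i + 1)) ↔ u = v i ∨ u = b i ∨ u = c i := by
  have hrest : ∀ w, w ≠ v (i + 1) → P w = P (v (i + 1)) → ∀ j, w ≠ v j := by
    intro w hw hP j hj
    subst hj
    exact hw (congrArg v (hinj hP))
  have hb := hrest (b i) (hne i).1 ((hf i _).2 (Or.inr (Or.inl rfl)))
  have hc := hrest (c i) (hne i).2 ((hf i _).2 (Or.inr (Or.inr rfl)))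
  constructor
  · intro h
    by_cases hu : ∃ j, u = v j
    · obtain ⟨j, rfl⟩ := hu
      rw [hQ] at h
      have := hinj h
      left
      congr 1
      exact add_right_cancel this
    · push Not at hu
      rw [hQ' u hu] at h
      rcases (hf i u).1 h with h | h | h
      · exact absurd h (hu _)
      · exact Or.inr (Or.inl h)
      · exact Or.inr (Or.inr h)
  · rintro (rfl | rfl | rfl)
    · exact hQ i
    · rw [hQ' _ hb]; exact (hf i _).2 (Or.inr (Or.inl rfl))
    · rw [hQ' _ hc]; exact (hf i _).2 (Or.inr (Or.inr rfl))

theorem fin_sub_one_add {l : ℕ} (i : Fin (l + 2)) : i - 1 + 1 = i := sub_add_cancel i 1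

theorem move_good {V : Type*} {G : SimpleGraph V} {k l : ℕ} {P Q : V → Fin k} (hP : Good G P)
    (h : Move G P Q l) : Good G Q := by
  obtain ⟨v, b, c, hinj, hQ, hQ', hf, hne, hbc, hvb⟩ := h
  have hfib := move_fiber hinj hQ hQ' hf hne
  intro i
  by_cases hi : ∃ j, i = P (v j)
  · obtain ⟨j, rfl⟩ := hi
    have := hfib (j - 1)
    rw [fin_sub_one_add] at this
    refine ⟨v (j - 1), b (j - 1), c (j - 1), ?_, hvb _, hbc _, this⟩
    intro h
    have h1 := (hf (j - 1) (c (j - 1))).2 (Or.inr (Or.inr rfl))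
    rw [← h] at h1
    have h2 := hinj h1
    exact (hne (j - 1)).2 (by rw [← h, ← h2])
  · push Not at hi
    obtain ⟨x, y, z, h1, h2, h3, h4⟩ := hP i
    refine ⟨x, y, z, h1, h2, h3, fun u => ?_⟩
    rw [← h4]
    by_cases hu : ∃ j, u = v j
    · obtain ⟨j, rfl⟩ := hu
      rw [hQ]
      exact ⟨fun h => absurd h.symm (hi _), fun h => absurd h.symm (hi _)⟩
    · push Not at hu
      rw [hQ' u hu]

theorem move_symm {V : Type*} {G : SimpleGraph V} {k l : ℕ} {P Q : V → Fin k} (hP : Good G P)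
    (h : Move G P Q l) : Move G Q P l := by
  obtain ⟨v, b, c, hinj, hQ, hQ', hf, hne, hbc, hvb⟩ := h
  have hfib := move_fiber hinj hQ hQ' hf hne
  have hadj : ∀ i, G.Adj (v (i + 1)) (b i) ∨ G.Adj (v (i + 1)) (c i) := by
    intro i
    obtain ⟨x, y, z, h1, h2, h3, h4⟩ := hP (P (v (i + 1)))
    have e : ∀ u, (u = x ∨ u = y ∨ u = z) ↔ (u = v (i + 1) ∨ u = b i ∨ u = c i) :=
      fun u => (h4 u).symm.trans (hf i u)
    have hv := (e (v (i + 1))).2 (Or.inl rfl)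
    have key : ∀ w, (w = x ∨ w = y ∨ w = z) → G.Adj (v (i + 1)) w →
        G.Adj (v (i + 1)) (b i) ∨ G.Adj (v (i + 1)) (c i) := by
      intro w hw ha
      rcases (e w).1 hw with rfl | rfl | rfl
      · exact absurd ha (G.loopless.irrefl _)
      · exact Or.inl ha
      · exact Or.inr ha
    rcases hv with hv | hv | hv
    · exact key y (by simp) (by rw [hv]; exact h2)
    · exact key z (by simp) (by rw [hv]; exact h3)
    · exact key y (by simp) (by rw [hv]; exact h3.symm)
  have hex : ∀ i : Fin (l + 2), ∃ b' c', (∀ u, (u = b' ∨ u = c') ↔ (u = b i ∨ u = c i)) ∧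
      G.Adj b' c' ∧ G.Adj (v (i + 1)) b' := by
    intro i
    rcases hadj i with h | h
    · exact ⟨b i, c i, fun u => Iff.rfl, hbc i, h⟩
    · exact ⟨c i, b i, fun u => or_comm, (hbc i).symm, h⟩
  choose b' c' he hbc' hvb' using hex
  have hrw : ∀ i : Fin (l + 2), -(i + 1) + 1 = -i := by intro i; rw [neg_add, neg_add_cancel_right]
  have hrest : ∀ i w, w ≠ v (i + 1) → P w = P (v (i + 1)) → ∀ j, w ≠ v j := by
    intro i w hw hP j hj
    subst hj
    exact hw (congrArg v (hinj hP))
  refine ⟨fun i => v (-i), fun i => b' (-(i + 1)), fun i => c' (-(i + 1)), ?_, ?_, ?_, ?_, ?_, ?_, ?_⟩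
  · intro i j hij
    simp only [hQ] at hij
    exact neg_injective (add_right_cancel (hinj hij))
  · intro i
    rw [hQ, hrw]
  · intro u hu
    refine (hQ' u fun i hi => hu (-i) ?_).symm
    simpa using hi
  · intro i u
    simp only [hQ]
    rw [hfib, ← he]
  · intro i
    have h1 := (he (-(i + 1)) (b' (-(i + 1)))).1 (Or.inl rfl)
    have h2 := (he (-(i + 1)) (c' (-(i + 1)))).1 (Or.inr rfl)
    have hb := hrest _ (b (-(i + 1))) (hne _).1 ((hf _ _).2 (Or.inr (Or.inl rfl)))
    have hc := hrest _ (c (-(i + 1))) (hne _).2 ((hf _ _).2 (Or.inr (Or.inr rfl)))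
    beta_reduce
    constructor
    · rcases h1 with h | h <;> rw [h]
      · exact hb _
      · exact hc _
    · rcases h2 with h | h <;> rw [h]
      · exact hb _
      · exact hc _
  · intro i; exact hbc' _
  · intro i
    have := hvb' (-(i + 1))
    rwa [hrw] at this

/-! ### The local checker -/

/-- Adjacency of cell codes `32 * (r + 2) + (c + 15)`. -/
def adjB (x y : ℕ) : Bool :=
  Nat.beq y (x + 1) || Nat.beq x (y + 1) || Nat.beq y (x + 32) || Nat.beq x (y + 32)

structure St where
  tiles : List (ℕ × ℕ × ℕ)
  ml : ℕ
  mh : ℕ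
  lo : ℕ
  lo' : ℕ
  hi : ℕ
  hi' : ℕ

def St.ok (s : St) : Bool := Nat.ble s.ml s.mh && Nat.ble s.lo s.lo' && Nat.ble s.hi s.hi'

def maxN (a b : ℕ) : ℕ := cond (Nat.ble a b) b a
def minN (a b : ℕ) : ℕ := cond (Nat.ble a b) a b

def St.inside (s : St) (x : ℕ) : St :=
  ⟨s.tiles, maxN s.ml (x / 32 + 1), s.mh, s.lo, minN s.lo' (x % 32 / 3),
    maxN s.hi (x % 32 / 3 + 1), s.hi'⟩

def posOk (x : ℕ) : Bool :=
  Nat.ble 96 x || (Nat.ble 64 x && Nat.ble 5 (x % 32 / 3))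

def inTile (x : ℕ) : ℕ × ℕ × ℕ → Bool
  | (a, b, c) => Nat.beq x a || Nat.beq x b || Nat.beq x c

noncomputable def occ (x : ℕ) (l : List (ℕ × ℕ × ℕ)) : Bool :=
  List.rec false (fun t _ ih => Bool.rec (Bool.rec (Bool.rec ih true (Nat.beq x t.2.2)) true
    (Nat.beq x t.2.1)) true (Nat.beq x t.1)) l

def keepOk (s : St) (l : List St) : List St := cond s.ok (s :: l) l

noncomputable def addTile (s : St) (t : ℕ × ℕ × ℕ) (l : List St) : List St :=
  match t with
  | (a, b, c) =>
    cond (posOk a && posOk b && posOk c && (((s.inside a).inside b).inside c).ok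
      && !(occ a s.tiles) && !(occ b s.tiles) && !(occ c s.tiles))
      (⟨(a, b, c) :: s.tiles, (((s.inside a).inside b).inside c).ml, s.mh, s.lo,
        (((s.inside a).inside b).inside c).lo', (((s.inside a).inside b).inside c).hi, s.hi'⟩ :: l) l

noncomputable def cands (x : ℕ) : List (ℕ × ℕ × ℕ) :=
  [(x-64,x-32,x), (x-33,x-32,x), (x-33,x-1,x), (x-32,x-31,x), (x-32,x-1,x), (x-32,x,x+1),
   (x-32,x,x+32), (x-31,x,x+1), (x-2,x-1,x), (x-1,x,x+1), (x-1,x,x+31), (x-1,x,x+32),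
   (x,x+1,x+2), (x,x+1,x+32), (x,x+1,x+33), (x,x+31,x+32), (x,x+32,x+33), (x,x+32,x+64)]

noncomputable def addTiles (s : St) : List (ℕ × ℕ × ℕ) → List St → List St
  | [], l => l
  | t :: ts, l => addTile s t (addTiles s ts l)

noncomputable def expand (s : St) (x : ℕ) (l : List St) : List St :=
  keepOk ⟨s.tiles, s.ml, minN s.mh (x / 32), s.lo, s.lo', s.hi, s.hi'⟩
    (keepOk ⟨s.tiles, s.ml, s.mh, maxN s.lo (x % 32 / 3 + 1), s.lo', s.hi, s.hi'⟩
      (keepOk ⟨s.tiles, s.ml, s.mh, s.lo, s.lo', s.hi, minN s.hi' (x % 32 / 3)⟩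
        (addTiles s (cands x) l)))

noncomputable def safe (x : ℕ) : Bool :=
  posOk x && Nat.ble x 575 && Nat.ble 2 (x % 32) && Nat.ble (x % 32) 27

/-- look up in an association list -/
noncomputable def lk (y : ℕ) (l : List (ℕ × ℕ)) : Option ℕ :=
  List.rec none (fun p _ ih => Bool.rec ih (some p.2) (Nat.beq y p.1)) l

noncomputable def mvTile (prs : List (ℕ × ℕ)) : ℕ × ℕ × ℕ → Option (ℕ × ℕ × ℕ)
  | (a, b, c) =>
    match lk a prs, lk b prs, lk c prs with
    | none, none, none => some (a, b, c)
    | some a', none, none => cond (adjB b c && (adjB a' b || adjB a' c)) (some (a', b, c)) none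
    | none, some b', none => cond (adjB a c && (adjB b' a || adjB b' c)) (some (a, b', c)) none
    | none, none, some c' => cond (adjB a b && (adjB c' a || adjB c' b)) (some (a, b, c')) none
    | _, _, _ => none

noncomputable def mvTiles (prs : List (ℕ × ℕ)) : List (ℕ × ℕ × ℕ) → Option (List (ℕ × ℕ × ℕ))
  | [] => some []
  | t :: ts =>
    match mvTile prs t, mvTiles prs ts with
    | some t', some ts' => some (t' :: ts')
    | _, _ => none

noncomputable def allOcc (tl : List (ℕ × ℕ × ℕ)) : List (ℕ × ℕ) → Bool
  | [] => true
  | (p, _) :: l => occ p tl && allOcc tl l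

noncomputable def nodupP : List (ℕ × ℕ) → Bool
  | [] => true
  | (p, _) :: l => (lk p l).isNone && nodupP l

noncomputable def prsOf : List ℕ → List (ℕ × ℕ)
  | [b, a] => [(b, a), (a, b)]
  | [c, b, a] => [(b, a), (c, b), (a, c)]
  | [d, c, b, a] => [(b, a), (c, b), (d, c), (a, d)]
  | _ => []

noncomputable def costOf : List ℕ → ℕ
  | [_, _] => 2
  | [_, _, _] => 3
  | [_, _, _, _] => 4
  | _ => 0

noncomputable def goalOk (tl : List (ℕ × ℕ × ℕ)) (budget : ℕ) : List ((ℕ × ℕ × ℕ) × ℕ) → Bool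
  | [] => false
  | ((a, b, c), w) :: gs =>
    (Nat.ble w budget && tl.any (fun t => inTile a t && inTile b t && inTile c t))
      || goalOk tl budget gs

/-- apply moves and test the goals -/
noncomputable def runMoves (goals : List ((ℕ × ℕ × ℕ) × ℕ)) :
    List (List ℕ) → ℕ → List (ℕ × ℕ × ℕ) → Bool
  | [], budget, tl => goalOk tl budget goals
  | mv :: mvs, budget, tl =>
    match prsOf mv with
    | [] => false
    | p :: ps =>
      nodupP (p :: ps) && allOcc tl (p :: ps) && Nat.ble (costOf mv) budget &&
        match mvTiles (p :: ps) tl with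
        | some tl' => runMoves goals mvs (budget - costOf mv) tl'
        | none => false

/-- decode the moves from a number -/
noncomputable def decode (f : ℕ) : ℕ → List ℕ → List (List ℕ) :=
  Nat.rec (fun _ _ => []) (fun _ ih n acc =>
    Bool.rec (Bool.rec (ih (Nat.div n 1024) (Nat.mod n 1024 :: acc))
      (acc :: ih (Nat.div n 1024) []) (Nat.beq (Nat.mod n 1024) 0))
      (List.rec [] (fun _ _ _ => [acc]) acc) (Nat.beq n 0)) f

noncomputable def checkFix (goals : List ((ℕ × ℕ × ℕ) × ℕ)) (budget : ℕ) (s : St) (n : ℕ) : Bool :=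
  runMoves goals (decode 60 n []) budget s.tiles

noncomputable def run (goals : List ((ℕ × ℕ × ℕ) × ℕ)) (budget : ℕ) : List ℕ → List St → Bool
  | _, [] => true
  | [], _ :: _ => false
  | t :: ts, s :: stk =>
    cond (Nat.beq (t % 2) 1)
      (checkFix goals budget s (t / 2) && run goals budget ts stk)
      (safe (t / 2) && !(occ (t / 2) s.tiles) && run goals budget ts (expand s (t / 2) stk))

/-- initial state with a single tile -/
noncomputable def St.ini (t : ℕ × ℕ × ℕ) : St :=
  match addTile ⟨[], 3, 22, 0, 5, 6, 10⟩ t [] with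
  | [] => ⟨[], 3, 22, 0, 5, 6, 10⟩
  | s :: _ => s

/-! ### Soundness of the checker -/

/-- Membership of a code in the window. -/
def InW (M lo hi x : ℕ) : Prop :=
  posOk x = true ∧ x / 32 < M ∧ lo ≤ x % 32 / 3 ∧ x % 32 / 3 < hi

/-- A window onto the graph. -/
structure Win {V : Type*} (G : SimpleGraph V) (U : Set V) (ψ : ℕ → V) (M lo hi : ℕ) : Prop where
  hM : 3 ≤ M
  hM' : M ≤ 22
  hlo : lo ≤ 5
  hhi : 6 ≤ hi
  hhi' : hi ≤ 10
  inj : ∀ x y, InW M lo hi x → InW M lo hi y → ψ x = ψ y → x = y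
  adj : ∀ x y, InW M lo hi x → InW M lo hi y → adjB x y = true → G.Adj (ψ x) (ψ y)
  mem : ∀ x, InW M lo hi x → ψ x ∈ U
  nbr : ∀ x w, InW M lo hi x → x / 32 ≤ 20 → 1 ≤ x % 32 → x % 32 ≤ 28 → w ∈ U →
    G.Adj (ψ x) w → ∃ y, InW M lo hi y ∧ adjB x y = true ∧ w = ψ y

def Mt (y : ℕ) (t : ℕ × ℕ × ℕ) : Prop := y = t.1 ∨ y = t.2.1 ∨ y = t.2.2

def SemT {V : Type*} (ψ : ℕ → V) (M lo hi : ℕ) {k : ℕ} (P : V → Fin k) (t : ℕ × ℕ × ℕ) : Prop :=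
  (∀ y, Mt y t → InW M lo hi y) ∧ ∃ i, ∀ u, P u = i ↔ ∃ y, Mt y t ∧ u = ψ y

structure Sem {V : Type*} (ψ : ℕ → V) (M lo hi : ℕ) {k : ℕ} (P : V → Fin k) (s : St) : Prop where
  ml : s.ml ≤ M
  mh : M ≤ s.mh
  l1 : s.lo ≤ lo
  l2 : lo ≤ s.lo'
  h1 : s.hi ≤ hi
  h2 : hi ≤ s.hi'
  tl : ∀ t ∈ s.tiles, SemT ψ M lo hi P t

structure TInv {V : Type*} (G : SimpleGraph V) (U : Set V) {k : ℕ} (P : V → Fin k) : Prop where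
  good : Good G P
  closed : ∀ u w, u ∈ U → P u = P w → w ∈ U

theorem inTile_iff (y : ℕ) (t : ℕ × ℕ × ℕ) : inTile y t = true ↔ Mt y t := by
  obtain ⟨a, b, c⟩ := t
  simp [inTile, Mt, or_assoc]

theorem occ_cons (x : ℕ) (t) (l : List (ℕ × ℕ × ℕ)) : occ x (t :: l) = (inTile x t || occ x l) := by
  obtain ⟨a, b, c⟩ := t
  show Bool.rec (Bool.rec (Bool.rec (occ x l) true (Nat.beq x c)) true
    (Nat.beq x b)) true (Nat.beq x a) = ((Nat.beq x a || Nat.beq x b || Nat.beq x c) || occ x l)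
  cases Nat.beq x a <;> cases Nat.beq x b <;> cases Nat.beq x c <;> simp

theorem occ_iff (x : ℕ) (l : List (ℕ × ℕ × ℕ)) : occ x l = true ↔ ∃ t ∈ l, Mt x t := by
  induction l with
  | nil => simp [occ]
  | cons t l ih => rw [occ_cons, Bool.or_eq_true, inTile_iff, ih]; simp

theorem lk_cons (y p q : ℕ) (l : List (ℕ × ℕ)) :
    lk y ((p, q) :: l) = if y = p then some q else lk y l := by
  show @Bool.rec (fun _ => Option ℕ) (lk y l) (some q) (Nat.beq y p) = _
  cases h : Nat.beq y p
  · rw [if_neg (Nat.ne_of_beq_eq_false h)]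
  · rw [if_pos (Nat.eq_of_beq_eq_true h)]

theorem lk_nil (y : ℕ) : lk y [] = none := rfl

theorem maxN_eq (a b : ℕ) : maxN a b = max a b := by
  unfold maxN
  cases h : Nat.ble a b
  · have : ¬ a ≤ b := fun h' => by rw [Nat.ble_eq_true_of_le h'] at h; exact absurd h (by simp)
    simp; omega
  · have := Nat.le_of_ble_eq_true h
    simp; omega

theorem minN_eq (a b : ℕ) : minN a b = min a b := by
  unfold minN
  cases h : Nat.ble a b
  · have : ¬ a ≤ b := fun h' => by rw [Nat.ble_eq_true_of_le h'] at h; exact absurd h (by simp)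
    simp; omega
  · have := Nat.le_of_ble_eq_true h
    simp; omega

theorem ok_iff (s : St) : s.ok = true ↔ s.ml ≤ s.mh ∧ s.lo ≤ s.lo' ∧ s.hi ≤ s.hi' := by
  simp [St.ok, and_assoc]

theorem mem_keepOk (s s' : St) (l : List St) :
    s' ∈ keepOk s l ↔ (s.ok = true ∧ s' = s) ∨ s' ∈ l := by
  unfold keepOk
  cases h : s.ok <;> simp

section sound
variable {V : Type*} {G : SimpleGraph V} {U : Set V} {ψ : ℕ → V} {M lo hi k : ℕ}

theorem Sem.ok {P : V → Fin k} {s : St} (h : Sem ψ M lo hi P s) : s.ok = true := by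
  rw [ok_iff]
  exact ⟨h.ml.trans h.mh, h.l1.trans h.l2, h.h1.trans h.h2⟩

theorem Sem.inside {P : V → Fin k} {s : St} (h : Sem ψ M lo hi P s) {x : ℕ}
    (hx : InW M lo hi x) : Sem ψ M lo hi P (s.inside x) := by
  obtain ⟨h1, h2, h3, h4⟩ := hx
  obtain ⟨a, b, c, d, e, f, g⟩ := h
  refine ⟨?_, b, c, ?_, ?_, f, g⟩ <;> simp only [St.inside, maxN_eq, minN_eq] <;> omega

theorem Sem.cons {P : V → Fin k} {s : St} (h : Sem ψ M lo hi P s) {t : ℕ × ℕ × ℕ}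
    (ht : SemT ψ M lo hi P t) :
    Sem ψ M lo hi P ⟨t :: s.tiles, s.ml, s.mh, s.lo, s.lo', s.hi, s.hi'⟩ := by
  obtain ⟨a, b, c, d, e, f, g⟩ := h
  refine ⟨a, b, c, d, e, f, ?_⟩
  intro t' ht'
  rcases List.mem_cons.1 ht' with rfl | h
  · exact ht
  · exact g _ h

theorem semT_overlap (W : Win G U ψ M lo hi) {P : V → Fin k} {t t' : ℕ × ℕ × ℕ}
    (ht : SemT ψ M lo hi P t) (ht' : SemT ψ M lo hi P t') {a x : ℕ} (ha : Mt a t) (ha' : Mt a t')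
    (hx : Mt x t) : Mt x t' := by
  obtain ⟨h1, i, hi⟩ := ht
  obtain ⟨h1', i', hi'⟩ := ht'
  have e1 := (hi (ψ a)).2 ⟨a, ha, rfl⟩
  have e2 := (hi' (ψ a)).2 ⟨a, ha', rfl⟩
  have e3 := (hi (ψ x)).2 ⟨x, hx, rfl⟩
  obtain ⟨y, hy, e⟩ := (hi' (ψ x)).1 (by rw [e3, ← e1, e2])
  have := W.inj _ _ (h1 _ hx) (h1' _ hy) e
  rwa [this]

theorem addTile_sound (W : Win G U ψ M lo hi) {P : V → Fin k} {s : St} (h : Sem ψ M lo hi P s)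
    {t : ℕ × ℕ × ℕ} (ht : SemT ψ M lo hi P t) {x : ℕ} (hx : Mt x t)
    (ho : occ x s.tiles = false) (l : List St) : ∃ s' ∈ addTile s t l, Sem ψ M lo hi P s' := by
  obtain ⟨a, b, c⟩ := t
  have ha := ht.1 a (Or.inl rfl)
  have hb := ht.1 b (Or.inr (Or.inl rfl))
  have hc := ht.1 c (Or.inr (Or.inr rfl))
  have hocc : ∀ y, Mt y (a, b, c) → occ y s.tiles = false := by
    intro y hy
    by_contra hcon
    rw [Bool.not_eq_false, occ_iff] at hcon
    obtain ⟨t', h1, h2⟩ := hcon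
    have : occ x s.tiles = true := (occ_iff _ _).2 ⟨t', h1, semT_overlap W ht (h.tl _ h1) hy h2 hx⟩
    rw [ho] at this
    exact absurd this (by simp)
  have hs := ((h.inside ha).inside hb).inside hc
  have := hs.cons ht
  unfold addTile
  simp only [ha.1, hb.1, hc.1, hs.ok, hocc a (Or.inl rfl), hocc b (Or.inr (Or.inl rfl)),
    hocc c (Or.inr (Or.inr rfl)), Bool.not_false, Bool.and_self, cond_true]
  exact ⟨_, List.mem_cons_self, this⟩

theorem addTile_sub (s : St) (t) (l : List St) : ∀ s' ∈ l, s' ∈ addTile s t l := by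
  intro s' h
  unfold addTile
  dsimp only
  generalize (posOk t.1 && posOk t.2.1 && posOk t.2.2 &&
    (((s.inside t.1).inside t.2.1).inside t.2.2).ok
      && !(occ t.1 s.tiles) && !(occ t.2.1 s.tiles) && !(occ t.2.2 s.tiles)) = q
  cases q
  · exact h
  · exact List.mem_cons_of_mem _ h

theorem addTiles_sub (s : St) (ts) (l : List St) : ∀ s' ∈ l, s' ∈ addTiles s ts l := by
  induction ts with
  | nil => exact fun _ h => h
  | cons t ts ih => exact fun s' h => addTile_sub _ _ _ _ (ih _ h)

theorem addTiles_sound (W : Win G U ψ M lo hi) {P : V → Fin k} {s : St} (h : Sem ψ M lo hi P s)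
    {t : ℕ × ℕ × ℕ} (ht : SemT ψ M lo hi P t) {x : ℕ} (hx : Mt x t)
    (ho : occ x s.tiles = false) (ts) (l : List St) (hts : t ∈ ts) :
    ∃ s' ∈ addTiles s ts l, Sem ψ M lo hi P s' := by
  induction ts with
  | nil => simp at hts
  | cons t' ts ih =>
    rcases List.mem_cons.1 hts with rfl | h'
    · exact addTile_sound W h ht hx ho _
    · obtain ⟨s', h1, h2⟩ := ih h'
      exact ⟨s', addTile_sub _ _ _ _ h1, h2⟩

theorem adjB_iff (x y : ℕ) :
    adjB x y = true ↔ y = x + 1 ∨ x = y + 1 ∨ y = x + 32 ∨ x = y + 32 := by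
  simp [adjB, or_assoc]

theorem posOk_le {x : ℕ} (h : posOk x = true) : 64 ≤ x := by
  simp only [posOk, Bool.or_eq_true, Bool.and_eq_true, Nat.ble_eq] at h
  omega

theorem cands_complete {x a b c : ℕ} (h64 : 64 ≤ x) (hab : adjB a b = true) (hbc : adjB b c = true)
    (hac : a ≠ c) (hx : x = a ∨ x = b ∨ x = c) :
    ∃ t ∈ cands x, ∀ y, Mt y t ↔ y = a ∨ y = b ∨ y = c := by
  rw [adjB_iff] at hab hbc
  have key : ∃ t ∈ cands x, (Mt a t ∧ Mt b t ∧ Mt c t ∧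
      (t.1 = a ∨ t.1 = b ∨ t.1 = c) ∧ (t.2.1 = a ∨ t.2.1 = b ∨ t.2.1 = c) ∧
      (t.2.2 = a ∨ t.2.2 = b ∨ t.2.2 = c)) := by
    have kk : ∀ p q r, (p, q, r) ∈ cands x → ((a = p ∨ a = q ∨ a = r) ∧ (b = p ∨ b = q ∨ b = r) ∧
        (c = p ∨ c = q ∨ c = r) ∧ (p = a ∨ p = b ∨ p = c) ∧ (q = a ∨ q = b ∨ q = c) ∧
        (r = a ∨ r = b ∨ r = c)) → ∃ t ∈ cands x, (Mt a t ∧ Mt b t ∧ Mt c t ∧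
      (t.1 = a ∨ t.1 = b ∨ t.1 = c) ∧ (t.2.1 = a ∨ t.2.1 = b ∨ t.2.1 = c) ∧
      (t.2.2 = a ∨ t.2.2 = b ∨ t.2.2 = c)) := fun p q r h1 h2 => ⟨(p, q, r), h1, h2⟩
    rcases hx with hx | hx | hx <;> rcases hab with h1 | h1 | h1 | h1 <;>
      rcases hbc with h2 | h2 | h2 | h2
    · exact kk x (x + 1) (x + 2) (by simp [cands]) (by omega)
    · omega
    · exact kk x (x + 1) (x + 33) (by simp [cands]) (by omega)
    · exact kk (x - 31) x (x + 1) (by simp [cands]) (by omega)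
    · omega
    · exact kk (x - 2) (x - 1) x (by simp [cands]) (by omega)
    · exact kk (x - 1) x (x + 31) (by simp [cands]) (by omega)
    · exact kk (x - 33) (x - 1) x (by simp [cands]) (by omega)
    · exact kk x (x + 32) (x + 33) (by simp [cands]) (by omega)
    · exact kk x (x + 31) (x + 32) (by simp [cands]) (by omega)
    · exact kk x (x + 32) (x + 64) (by simp [cands]) (by omega)
    · omega
    · exact kk (x - 32) (x - 31) x (by simp [cands]) (by omega)
    · exact kk (x - 33) (x - 32) x (by simp [cands]) (by omega)
    · omega
    · exact kk (x - 64) (x - 32) x (by simp [cands]) (by omega)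
    · exact kk (x - 1) x (x + 1) (by simp [cands]) (by omega)
    · omega
    · exact kk (x - 1) x (x + 32) (by simp [cands]) (by omega)
    · exact kk (x - 32) (x - 1) x (by simp [cands]) (by omega)
    · omega
    · exact kk (x - 1) x (x + 1) (by simp [cands]) (by omega)
    · exact kk x (x + 1) (x + 32) (by simp [cands]) (by omega)
    · exact kk (x - 32) x (x + 1) (by simp [cands]) (by omega)
    · exact kk (x - 32) x (x + 1) (by simp [cands]) (by omega)
    · exact kk (x - 32) (x - 1) x (by simp [cands]) (by omega)
    · exact kk (x - 32) x (x + 32) (by simp [cands]) (by omega)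
    · omega
    · exact kk x (x + 1) (x + 32) (by simp [cands]) (by omega)
    · exact kk (x - 1) x (x + 32) (by simp [cands]) (by omega)
    · omega
    · exact kk (x - 32) x (x + 32) (by simp [cands]) (by omega)
    · exact kk (x - 2) (x - 1) x (by simp [cands]) (by omega)
    · omega
    · exact kk (x - 33) (x - 32) x (by simp [cands]) (by omega)
    · exact kk x (x + 31) (x + 32) (by simp [cands]) (by omega)
    · omega
    · exact kk x (x + 1) (x + 2) (by simp [cands]) (by omega)
    · exact kk (x - 32) (x - 31) x (by simp [cands]) (by omega)
    · exact kk x (x + 32) (x + 33) (by simp [cands]) (by omega)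
    · exact kk (x - 33) (x - 1) x (by simp [cands]) (by omega)
    · exact kk (x - 31) x (x + 1) (by simp [cands]) (by omega)
    · exact kk (x - 64) (x - 32) x (by simp [cands]) (by omega)
    · omega
    · exact kk (x - 1) x (x + 31) (by simp [cands]) (by omega)
    · exact kk x (x + 1) (x + 33) (by simp [cands]) (by omega)
    · omega
    · exact kk x (x + 32) (x + 64) (by simp [cands]) (by omega)
  obtain ⟨t, ht, h1, h2, h3, h4, h5, h6⟩ := key
  refine ⟨t, ht, fun y => ⟨?_, ?_⟩⟩
  · rintro (rfl | rfl | rfl)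
    · exact h4
    · exact h5
    · exact h6
  · rintro (rfl | rfl | rfl)
    · exact h1
    · exact h2
    · exact h3

theorem safe_spec {x : ℕ} (h : safe x = true) :
    posOk x = true ∧ x ≤ 575 ∧ 2 ≤ x % 32 ∧ x % 32 ≤ 27 := by
  simpa [safe, and_assoc] using h

theorem cands_sound (W : Win G U ψ M lo hi) {P : V → Fin k} (hP : TInv G U P) {x : ℕ}
    (hx : InW M lo hi x) (hs : safe x = true) :
    ∃ t ∈ cands x, SemT ψ M lo hi P t ∧ Mt x t := by
  obtain ⟨hp, s1, s2, s3⟩ := safe_spec hs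
  have h64 := posOk_le hp
  obtain ⟨a, b, c, hac, hab, hbc, hf⟩ := hP.good (P (ψ x))
  have hxx := (hf (ψ x)).1 rfl
  have hxU := W.mem x hx
  have hU : ∀ u, (u = a ∨ u = b ∨ u = c) → u ∈ U := fun u hu =>
    hP.closed _ _ hxU ((hf u).2 hu).symm
  -- codes
  have step1 : ∀ w, w ∈ U → G.Adj (ψ x) w → ∃ y, InW M lo hi y ∧ adjB x y = true ∧ w = ψ y :=
    fun w hw hadj => W.nbr x w hx (by omega) (by omega) (by omega) hw hadj
  have step2 : ∀ y w, InW M lo hi y → adjB x y = true → w ∈ U → G.Adj (ψ y) w →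
      ∃ z, InW M lo hi z ∧ adjB y z = true ∧ w = ψ z := by
    intro y w hy hxy hw hadj
    rw [adjB_iff] at hxy
    exact W.nbr y w hy (by omega) (by omega) (by omega) hw hadj
  have sym : ∀ p q, adjB p q = true → adjB q p = true := by
    intro p q h
    rw [adjB_iff] at h ⊢
    omega
  have codes : ∃ ya yb yc, InW M lo hi ya ∧ InW M lo hi yb ∧ InW M lo hi yc ∧ a = ψ ya ∧ b = ψ yb ∧
      c = ψ yc ∧ adjB ya yb = true ∧ adjB yb yc = true ∧ (x = ya ∨ x = yb ∨ x = yc) := by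
    rcases hxx with h | h | h
    · rw [← h] at hab
      obtain ⟨yb, i1, i2, i3⟩ := step1 b (hU b (by simp)) hab
      rw [i3] at hbc
      obtain ⟨yc, j1, j2, j3⟩ := step2 yb c i1 i2 (hU c (by simp)) hbc
      exact ⟨x, yb, yc, hx, i1, j1, h.symm, i3, j3, i2, j2, Or.inl rfl⟩
    · rw [← h] at hab hbc
      obtain ⟨ya, i1, i2, i3⟩ := step1 a (hU a (by simp)) hab.symm
      obtain ⟨yc, j1, j2, j3⟩ := step1 c (hU c (by simp)) hbc
      exact ⟨ya, x, yc, i1, hx, j1, i3, h.symm, j3, sym _ _ i2, j2, Or.inr (Or.inl rfl)⟩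
    · rw [← h] at hbc
      obtain ⟨yb, i1, i2, i3⟩ := step1 b (hU b (by simp)) hbc.symm
      rw [i3] at hab
      obtain ⟨ya, j1, j2, j3⟩ := step2 yb a i1 i2 (hU a (by simp)) hab.symm
      exact ⟨ya, yb, x, j1, i1, hx, j3, i3, h.symm, sym _ _ j2, sym _ _ i2, Or.inr (Or.inr rfl)⟩
  obtain ⟨ya, yb, yc, i1, i2, i3, rfl, rfl, rfl, k1, k2, k3⟩ := codes
  obtain ⟨t, ht, hy⟩ := cands_complete h64 k1 k2 (fun h => hac (by rw [h])) k3
  refine ⟨t, ht, ⟨fun y hyt => ?_, P (ψ x), fun u => ?_⟩, (hy x).2 k3⟩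
  · rcases (hy y).1 hyt with rfl | rfl | rfl
    · exact i1
    · exact i2
    · exact i3
  · rw [hf]
    simp only [hy]
    constructor
    · rintro (h | h | h)
      · exact ⟨ya, by simp, h⟩
      · exact ⟨yb, by simp, h⟩
      · exact ⟨yc, by simp, h⟩
    · rintro ⟨y, rfl | rfl | rfl, h⟩ <;> simp [h]

theorem expand_sub (s : St) (x : ℕ) (l : List St) : ∀ s' ∈ l, s' ∈ expand s x l := by
  intro s' h
  unfold expand
  simp only [mem_keepOk]
  exact Or.inr (Or.inr (Or.inr (addTiles_sub _ _ _ _ h)))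

theorem expand_sound (W : Win G U ψ M lo hi) {P : V → Fin k} (hP : TInv G U P) {s : St}
    (h : Sem ψ M lo hi P s) {x : ℕ} (hs : safe x = true) (ho : occ x s.tiles = false)
    (l : List St) : ∃ s' ∈ expand s x l, Sem ψ M lo hi P s' := by
  have hp := (safe_spec hs).1
  unfold expand
  by_cases h1 : x / 32 < M
  · by_cases h2 : lo ≤ x % 32 / 3
    · by_cases h3 : x % 32 / 3 < hi
      · obtain ⟨t, ht, h4, h5⟩ := cands_sound W hP ⟨hp, h1, h2, h3⟩ hs
        obtain ⟨s', h6, h7⟩ := addTiles_sound W h h4 h5 ho (cands x) l ht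
        refine ⟨s', ?_, h7⟩
        simp only [mem_keepOk]
        exact Or.inr (Or.inr (Or.inr h6))
      · obtain ⟨a, b, c, d, e, f, g⟩ := h
        have hS : Sem ψ M lo hi P ⟨s.tiles, s.ml, s.mh, s.lo, s.lo', s.hi, minN s.hi' (x % 32 / 3)⟩ :=
          ⟨a, b, c, d, e, by rw [minN_eq]; show hi ≤ min _ _; omega, g⟩
        refine ⟨_, ?_, hS⟩
        rw [mem_keepOk, mem_keepOk, mem_keepOk]
        exact Or.inr (Or.inr (Or.inl ⟨hS.ok, rfl⟩))
    · obtain ⟨a, b, c, d, e, f, g⟩ := h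
      have hS : Sem ψ M lo hi P ⟨s.tiles, s.ml, s.mh, maxN s.lo (x % 32 / 3 + 1), s.lo', s.hi, s.hi'⟩ :=
        ⟨a, b, by rw [maxN_eq]; show max _ _ ≤ lo; omega, d, e, f, g⟩
      refine ⟨_, ?_, hS⟩
      rw [mem_keepOk, mem_keepOk]
      exact Or.inr (Or.inl ⟨hS.ok, rfl⟩)
  · obtain ⟨a, b, c, d, e, f, g⟩ := h
    have hS : Sem ψ M lo hi P ⟨s.tiles, s.ml, minN s.mh (x / 32), s.lo, s.lo', s.hi, s.hi'⟩ :=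
      ⟨a, by rw [minN_eq]; show M ≤ min _ _; omega, c, d, e, f, g⟩
    refine ⟨_, ?_, hS⟩
    rw [mem_keepOk]
    exact Or.inl ⟨hS.ok, rfl⟩

end sound

section sound2
variable {V : Type*} {G : SimpleGraph V} {U : Set V} {ψ : ℕ → V} {M lo hi k : ℕ}

theorem mvTile_spec {prs : List (ℕ × ℕ)} {t t' : ℕ × ℕ × ℕ} (h : mvTile prs t = some t') :
    ((∀ y, Mt y t → lk y prs = none) ∧ t' = t) ∨
    ∃ x x' b c, lk x prs = some x' ∧ lk b prs = none ∧ lk c prs = none ∧ adjB b c = true ∧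
      adjB x' b = true ∧ (∀ y, Mt y t ↔ y = x ∨ y = b ∨ y = c) ∧
      (∀ y, Mt y t' ↔ y = x' ∨ y = b ∨ y = c) := by
  obtain ⟨p, q, r⟩ := t
  have sym : ∀ p q, adjB p q = true → adjB q p = true := by
    intro p q h
    rw [adjB_iff] at h ⊢
    omega
  unfold mvTile at h
  rcases hp : lk p prs with _ | p' <;> rcases hq : lk q prs with _ | q' <;>
    rcases hr : lk r prs with _ | r' <;> simp only [hp, hq, hr] at h
  · left
    simp only [Option.some.injEq] at h
    refine ⟨?_, h.symm⟩
    rintro y (rfl | rfl | rfl) <;> assumption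
  · right
    rcases hc : (adjB p q && (adjB r' p || adjB r' q)) with _ | _ <;> simp only [hc] at h
    · exact absurd h (by simp)
    · simp only [Bool.and_eq_true, Bool.or_eq_true] at hc
      obtain rfl : (p, q, r') = t' := by simpa using h
      rcases hc with ⟨h1, h2 | h2⟩
      · exact ⟨r, r', p, q, hr, hp, hq, h1, h2, fun y => by simp only [Mt]; tauto,
          fun y => by simp only [Mt]; tauto⟩
      · exact ⟨r, r', q, p, hr, hq, hp, sym _ _ h1, h2, fun y => by simp only [Mt]; tauto,
          fun y => by simp only [Mt]; tauto⟩
  · right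
    rcases hc : (adjB p r && (adjB q' p || adjB q' r)) with _ | _ <;> simp only [hc] at h
    · exact absurd h (by simp)
    · simp only [Bool.and_eq_true, Bool.or_eq_true] at hc
      obtain rfl : (p, q', r) = t' := by simpa using h
      rcases hc with ⟨h1, h2 | h2⟩
      · exact ⟨q, q', p, r, hq, hp, hr, h1, h2, fun y => by simp only [Mt]; tauto,
          fun y => by simp only [Mt]; tauto⟩
      · exact ⟨q, q', r, p, hq, hr, hp, sym _ _ h1, h2, fun y => by simp only [Mt]; tauto,
          fun y => by simp only [Mt]; tauto⟩
  · exact absurd h (by simp)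
  · right
    rcases hc : (adjB q r && (adjB p' q || adjB p' r)) with _ | _ <;> simp only [hc] at h
    · exact absurd h (by simp)
    · simp only [Bool.and_eq_true, Bool.or_eq_true] at hc
      obtain rfl : (p', q, r) = t' := by simpa using h
      rcases hc with ⟨h1, h2 | h2⟩
      · exact ⟨p, p', q, r, hp, hq, hr, h1, h2, fun y => by simp only [Mt],
          fun y => by simp only [Mt]⟩
      · exact ⟨p, p', r, q, hp, hr, hq, sym _ _ h1, h2, fun y => by simp only [Mt]; tauto,
          fun y => by simp only [Mt]; tauto⟩
  · exact absurd h (by simp)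
  · exact absurd h (by simp)
  · exact absurd h (by simp)

theorem mvTiles_spec {prs : List (ℕ × ℕ)} {tl tl' : List (ℕ × ℕ × ℕ)}
    (h : mvTiles prs tl = some tl') :
    (∀ t ∈ tl, ∃ t', mvTile prs t = some t') ∧ (∀ t' ∈ tl', ∃ t ∈ tl, mvTile prs t = some t') := by
  induction tl generalizing tl' with
  | nil =>
    simp only [mvTiles, Option.some.injEq] at h
    subst h
    simp
  | cons t ts ih =>
    rw [mvTiles] at h
    rcases h1 : mvTile prs t with _ | t' <;> rcases h2 : mvTiles prs ts with _ | ts' <;>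
      simp only [h1, h2] at h
    · exact absurd h (by simp)
    · exact absurd h (by simp)
    · exact absurd h (by simp)
    · obtain rfl : t' :: ts' = tl' := by simpa using h
      obtain ⟨i1, i2⟩ := ih h2
      constructor
      · intro s hs
        rcases List.mem_cons.1 hs with rfl | hs
        · exact ⟨_, h1⟩
        · exact i1 _ hs
      · intro s hs
        rcases List.mem_cons.1 hs with rfl | hs
        · exact ⟨_, List.mem_cons_self, h1⟩
        · obtain ⟨a, b, c⟩ := i2 _ hs
          exact ⟨a, List.mem_cons_of_mem _ b, c⟩

/-- One elementary move is simulated. -/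
theorem step_sound (W : Win G U ψ M lo hi) {P : V → Fin k} (hP : TInv G U P)
    {tl tl' : List (ℕ × ℕ × ℕ)} (htl : ∀ t ∈ tl, SemT ψ M lo hi P t) {l : ℕ}
    (v : Fin (l + 2) → ℕ) (hv : Function.Injective v) {prs : List (ℕ × ℕ)}
    (hlk : ∀ y y', lk y prs = some y' ↔ ∃ i, y = v (i + 1) ∧ y' = v i)
    (hocc : ∀ i, occ (v i) tl = true) (hmv : mvTiles prs tl = some tl') :
    ∃ Q, Move G P Q l ∧ TInv G U Q ∧ (∀ u, u ∉ U → Q u = P u) ∧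
      ∀ t ∈ tl', SemT ψ M lo hi Q t := by
  classical
  obtain ⟨m1, m2⟩ := mvTiles_spec hmv
  have hnone : ∀ y, lk y prs = none → ∀ i, y ≠ v i := by
    intro y hy i hi
    have := (hlk y (v (i - 1))).2 ⟨i - 1, by rw [fin_sub_one_add]; exact hi, rfl⟩
    rw [hy] at this
    exact absurd this (by simp)
  have hsome : ∀ i, lk (v (i + 1)) prs = some (v i) := fun i => (hlk _ _).2 ⟨i, rfl, rfl⟩
  have hIn : ∀ i, InW M lo hi (v i) := by
    intro i
    obtain ⟨t, ht, h⟩ := (occ_iff _ _).1 (hocc i)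
    exact (htl t ht).1 _ h
  have htile : ∀ i, ∃ b c, lk b prs = none ∧ lk c prs = none ∧ InW M lo hi b ∧ InW M lo hi c ∧
      adjB b c = true ∧ adjB (v i) b = true ∧
      ∀ u, P u = P (ψ (v (i + 1))) ↔ u = ψ (v (i + 1)) ∨ u = ψ b ∨ u = ψ c := by
    intro i
    obtain ⟨t, ht, h⟩ := (occ_iff _ _).1 (hocc (i + 1))
    obtain ⟨t', ht'⟩ := m1 t ht
    rcases mvTile_spec ht' with ⟨h1, _⟩ | ⟨x, x', b, c, h1, h2, h3, h4, h5, h6, h7⟩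
    · have := h1 _ h
      rw [hsome] at this
      exact absurd this (by simp)
    · have hx : v (i + 1) = x := by
        rcases (h6 _).1 h with h | h | h
        · exact h
        · exact absurd h.symm (hnone _ h2 _)
        · exact absurd h.symm (hnone _ h3 _)
      subst hx
      have hx' : v i = x' := by
        have := hsome i
        rw [h1] at this
        simpa using this.symm
      subst hx'
      obtain ⟨g1, j, g2⟩ := htl t ht
      refine ⟨b, c, h2, h3, g1 _ ((h6 _).2 (by simp)), g1 _ ((h6 _).2 (by simp)), h4, h5, fun u => ?_⟩
      have : P (ψ (v (i + 1))) = j := (g2 _).2 ⟨_, h, rfl⟩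
      rw [this, g2]
      simp only [h6]
      constructor
      · rintro ⟨y, rfl | rfl | rfl, h⟩ <;> simp [h]
      · rintro (h | h | h)
        · exact ⟨_, by simp, h⟩
        · exact ⟨b, by simp, h⟩
        · exact ⟨c, by simp, h⟩
  choose b c hb hc hIb hIc hbc hvb hfib using htile
  have hψ : ∀ y, InW M lo hi y → lk y prs = none → ∀ i, ψ y ≠ ψ (v i) := by
    intro y hy hy' i he
    exact hnone y hy' i (W.inj _ _ hy (hIn i) he)
  have hinj : Function.Injective (fun i => P (ψ (v i))) := by
    intro i j hij
    have h0 : P (ψ (v j)) = P (ψ (v ((i - 1) + 1))) := by rw [fin_sub_one_add]; exact hij.symm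
    rcases (hfib (i - 1) _).1 h0 with h | h | h
    · rw [fin_sub_one_add] at h
      exact (hv (W.inj _ _ (hIn _) (hIn _) h)).symm
    · exact absurd h.symm (hψ _ (hIb _) (hb _) _)
    · exact absurd h.symm (hψ _ (hIc _) (hc _) _)
  let Q : V → Fin k := fun u => if h : ∃ i, u = ψ (v i) then P (ψ (v (h.choose + 1))) else P u
  have hQ : ∀ i, Q (ψ (v i)) = P (ψ (v (i + 1))) := by
    intro i
    have h : ∃ j, ψ (v i) = ψ (v j) := ⟨i, rfl⟩
    have h2 : i = h.choose := hv (W.inj _ _ (hIn _) (hIn _) h.choose_spec)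
    show (if h : ∃ j, ψ (v i) = ψ (v j) then P (ψ (v (h.choose + 1))) else P (ψ (v i))) = _
    rw [dif_pos h, ← h2]
  have hQ' : ∀ u, (∀ i, u ≠ ψ (v i)) → Q u = P u := by
    intro u hu
    show (if h : ∃ j, u = ψ (v j) then P (ψ (v (h.choose + 1))) else P u) = _
    rw [dif_neg]
    push Not
    exact hu
  have hne : ∀ i, ψ (b i) ≠ ψ (v (i + 1)) ∧ ψ (c i) ≠ ψ (v (i + 1)) :=
    fun i => ⟨hψ _ (hIb i) (hb i) _, hψ _ (hIc i) (hc i) _⟩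
  have hmove : Move G P Q l := ⟨fun i => ψ (v i), fun i => ψ (b i), fun i => ψ (c i), hinj, hQ, hQ',
    hfib, hne, fun i => W.adj _ _ (hIb i) (hIc i) (hbc i), fun i => W.adj _ _ (hIn i) (hIb i) (hvb i)⟩
  have hfQ := move_fiber hinj hQ hQ' hfib hne
  have hoff : ∀ u, u ∉ U → Q u = P u := by
    intro u hu
    apply hQ'
    rintro i rfl
    exact hu (W.mem _ (hIn i))
  refine ⟨Q, hmove, ⟨move_good hP.good hmove, ?_⟩, hoff, ?_⟩
  · intro u w hu he
    by_contra hw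
    rw [hoff w hw] at he
    by_cases h : ∃ i, u = ψ (v i)
    · obtain ⟨i, rfl⟩ := h
      rw [hQ] at he
      exact hw (hP.closed _ _ (W.mem _ (hIn _)) he)
    · push Not at h
      rw [hQ' u h] at he
      exact hw (hP.closed _ _ hu he)
  · intro t' ht'
    obtain ⟨t, ht, hm⟩ := m2 t' ht'
    obtain ⟨g1, j, g2⟩ := htl t ht
    rcases mvTile_spec hm with ⟨h1, rfl⟩ | ⟨x, x', b', c', h1, h2, h3, h4, h5, h6, h7⟩
    · refine ⟨g1, j, fun u => ?_⟩
      rw [← g2]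
      by_cases h : ∃ i, u = ψ (v i)
      · obtain ⟨i, rfl⟩ := h
        have : ∀ i, P (ψ (v i)) ≠ j := by
          intro i hi
          obtain ⟨y, hy, hy'⟩ := (g2 _).1 hi
          exact hψ y (g1 _ hy) (h1 _ hy) i hy'.symm
        rw [hQ]
        exact ⟨fun h => absurd h (this _), fun h => absurd h (this _)⟩
      · push Not at h
        rw [hQ' u h]
    · obtain ⟨i, rfl, rfl⟩ := (hlk _ _).1 h1
      have e1 : P (ψ (v (i + 1))) = j := (g2 _).2 ⟨_, (h6 _).2 (by simp), rfl⟩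
      have gb := g1 b' ((h6 _).2 (by simp))
      have gc := g1 c' ((h6 _).2 (by simp))
      refine ⟨?_, j, fun u => ?_⟩
      · intro y hy
        rcases (h7 y).1 hy with rfl | rfl | rfl
        · exact hIn _
        · exact gb
        · exact gc
      · by_cases h : ∃ i, u = ψ (v i)
        · obtain ⟨i', rfl⟩ := h
          rw [hQ, ← e1]
          constructor
          · intro h
            have := add_right_cancel (hinj h)
            subst this
            exact ⟨_, (h7 _).2 (by simp), rfl⟩
          · rintro ⟨y, hy, hy'⟩
            rcases (h7 y).1 hy with rfl | rfl | rfl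
            · rw [hv (W.inj _ _ (hIn _) (hIn _) hy')]
            · exact absurd hy'.symm (hψ _ gb h2 _)
            · exact absurd hy'.symm (hψ _ gc h3 _)
        · push Not at h
          rw [hQ' u h, g2]
          simp only [h6, h7]
          constructor
          · rintro ⟨y, rfl | hy, hu⟩
            · exact absurd hu (h _)
            · exact ⟨y, Or.inr hy, hu⟩
          · rintro ⟨y, rfl | hy, hu⟩
            · exact absurd hu (h _)
            · exact ⟨y, Or.inr hy, hu⟩

/-- The corner tile can be made horizontal within the budget. -/
def Done (G : SimpleGraph V) (U : Set V) (ψ : ℕ → V) (M lo hi : ℕ) (w : ℕ) (P : V → Fin k) : Prop :=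
  ∃ Q w', w' ≤ w ∧ Reach G w' P Q ∧ TInv G U Q ∧ (∀ u, u ∉ U → Q u = P u) ∧
    SemT ψ M lo hi Q (79, 80, 81)

def Solved (G : SimpleGraph V) (U : Set V) (ψ : ℕ → V) (M lo hi k : ℕ)
    (g : (ℕ × ℕ × ℕ) × ℕ) : Prop :=
  (g.1.1 ≠ g.1.2.1 ∧ g.1.1 ≠ g.1.2.2 ∧ g.1.2.1 ≠ g.1.2.2) ∧
    ∀ P : V → Fin k, TInv G U P → SemT ψ M lo hi P g.1 → Done G U ψ M lo hi g.2 P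

theorem Done.mono {w w' : ℕ} {P : V → Fin k} (h : Done G U ψ M lo hi w P) (hw : w ≤ w') :
    Done G U ψ M lo hi w' P := by
  obtain ⟨Q, c, h1, h2⟩ := h
  exact ⟨Q, c, h1.trans hw, h2⟩

theorem goalOk_sound {goals} (hg : ∀ g ∈ goals, Solved G U ψ M lo hi k g)
    {P : V → Fin k} (hP : TInv G U P) {tl : List (ℕ × ℕ × ℕ)}
    (htl : ∀ t ∈ tl, SemT ψ M lo hi P t) {budget : ℕ} (h : goalOk tl budget goals = true) :
    Done G U ψ M lo hi budget P := by
  induction goals with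
  | nil => exact absurd h (by simp [goalOk])
  | cons g gs ih =>
    obtain ⟨⟨a, b, c⟩, w⟩ := g
    simp only [goalOk, Bool.or_eq_true, Bool.and_eq_true, Nat.ble_eq, List.any_eq_true] at h
    rcases h with ⟨h1, t, ht, ⟨ha, hb⟩, hc⟩ | h
    · rw [inTile_iff] at ha hb hc
      obtain ⟨⟨n1, n2, n3⟩, hs⟩ := hg _ List.mem_cons_self
      refine (hs P hP ?_).mono h1
      obtain ⟨g1, j, g2⟩ := htl t ht
      have e : ∀ y, Mt y (a, b, c) ↔ Mt y t := by
        intro y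
        obtain ⟨p, q, r⟩ := t
        simp only [Mt] at *
        omega
      exact ⟨fun y hy => g1 y ((e y).1 hy), j, fun u => by rw [g2]; simp only [e]⟩
    · exact ih (fun g hgs => hg g (List.mem_cons_of_mem _ hgs)) h

theorem Done.step {P Q : V → Fin k} {l w w' : ℕ} (hP : TInv G U P) (hQ : TInv G U Q)
    (hm : Move G P Q l) (ho : ∀ u, u ∉ U → Q u = P u) (h : Done G U ψ M lo hi w Q)
    (hw : l + 2 + w ≤ w') : Done G U ψ M lo hi w' P := by
  obtain ⟨R, c, h1, h2, h3, h4, h5⟩ := h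
  exact ⟨R, l + 2 + c, by omega, Reach.step hP.good hQ.good hm h2, h3,
    fun u hu => (h4 u hu).trans (ho u hu), h5⟩

theorem allOcc_spec {tl : List (ℕ × ℕ × ℕ)} {l : List (ℕ × ℕ)} (h : allOcc tl l = true) :
    ∀ p ∈ l, occ p.1 tl = true := by
  induction l with
  | nil => simp
  | cons p l ih =>
    obtain ⟨p, q⟩ := p
    simp only [allOcc, Bool.and_eq_true] at h
    intro r hr
    rcases List.mem_cons.1 hr with rfl | hr
    · exact h.1
    · exact ih h.2 r hr

theorem lk_mem {y y' : ℕ} {l : List (ℕ × ℕ)} (h : lk y l = some y') : (y, y') ∈ l := by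
  induction l with
  | nil => exact absurd h (by simp [lk_nil])
  | cons p l ih =>
    obtain ⟨p, q⟩ := p
    rw [lk_cons] at h
    split_ifs at h with hy
    · simp at h
      simp [hy, h]
    · exact List.mem_cons_of_mem _ (ih h)

theorem hocc_of {l : ℕ} {v : Fin (l + 2) → ℕ} {prs : List (ℕ × ℕ)} {tl : List (ℕ × ℕ × ℕ)}
    (hlk : ∀ y y', lk y prs = some y' ↔ ∃ i, y = v (i + 1) ∧ y' = v i)
    (h : ∀ p ∈ prs, occ p.1 tl = true) (i : Fin (l + 2)) : occ (v i) tl = true := by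
  have := h _ (lk_mem ((hlk (v i) (v (i - 1))).2 ⟨i - 1, by rw [fin_sub_one_add], rfl⟩))
  exact this

theorem prs2 (a b : ℕ) (h1 : nodupP [(b, a), (a, b)] = true) : Function.Injective ![a, b] ∧
    ∀ y y', lk y [(b, a), (a, b)] = some y' ↔
      ∃ i : Fin (0 + 2), y = ![a, b] (i + 1) ∧ y' = ![a, b] i := by
  simp [nodupP, lk_cons, lk_nil] at h1
  constructor
  · intro i j hij
    fin_cases i <;> fin_cases j <;> simp_all
  · intro y y'
    have : ∀ p : Fin 2 → Prop, (∃ i, p i) ↔ p 0 ∨ p 1 := by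
      intro p; simp [Fin.exists_fin_succ]
    rw [this]
    simp [lk_cons, lk_nil]
    grind

theorem prs3 (a b c : ℕ) (h1 : nodupP [(b, a), (c, b), (a, c)] = true) :
    Function.Injective ![a, b, c] ∧ ∀ y y', lk y [(b, a), (c, b), (a, c)] = some y' ↔
      ∃ i : Fin (1 + 2), y = ![a, b, c] (i + 1) ∧ y' = ![a, b, c] i := by
  simp [nodupP, lk_cons, lk_nil] at h1
  constructor
  · intro i j hij
    fin_cases i <;> fin_cases j <;> simp_all
  · intro y y'
    have : ∀ p : Fin 3 → Prop, (∃ i, p i) ↔ p 0 ∨ p 1 ∨ p 2 := by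
      intro p; simp [Fin.exists_fin_succ]
    rw [this]
    show _ ↔ (y = b ∧ y' = a) ∨ (y = c ∧ y' = b) ∨ (y = a ∧ y' = c)
    simp [lk_cons, lk_nil]
    grind

theorem prs4 (a b c d : ℕ) (h1 : nodupP [(b, a), (c, b), (d, c), (a, d)] = true) :
    Function.Injective ![a, b, c, d] ∧ ∀ y y', lk y [(b, a), (c, b), (d, c), (a, d)] = some y' ↔
      ∃ i : Fin (2 + 2), y = ![a, b, c, d] (i + 1) ∧ y' = ![a, b, c, d] i := by
  simp [nodupP, lk_cons, lk_nil] at h1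
  have h2 : a ≠ b ∧ a ≠ c ∧ a ≠ d ∧ b ≠ c ∧ b ≠ d ∧ c ≠ d := by grind
  clear h1
  constructor
  · intro i j hij
    fin_cases i <;> fin_cases j <;> simp_all
  · intro y y'
    have : ∀ p : Fin 4 → Prop, (∃ i, p i) ↔ p 0 ∨ p 1 ∨ p 2 ∨ p 3 := by
      intro p; simp [Fin.exists_fin_succ]
    rw [this]
    show _ ↔ (y = b ∧ y' = a) ∨ (y = c ∧ y' = b) ∨ (y = d ∧ y' = c) ∨ (y = a ∧ y' = d)
    simp [lk_cons, lk_nil]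
    grind

theorem runMoves_sound (W : Win G U ψ M lo hi) {goals} (hg : ∀ g ∈ goals, Solved G U ψ M lo hi k g)
    (mvs : List (List ℕ)) : ∀ (budget : ℕ) (tl : List (ℕ × ℕ × ℕ)) (P : V → Fin k), TInv G U P →
    (∀ t ∈ tl, SemT ψ M lo hi P t) → runMoves goals mvs budget tl = true →
    Done G U ψ M lo hi budget P := by
  induction mvs with
  | nil => exact fun budget tl P hP htl h => goalOk_sound hg hP htl h
  | cons mv mvs ih =>
    intro budget tl P hP htl h
    rw [runMoves] at h
    rcases hprs : prsOf mv with _ | ⟨p, ps⟩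
    · rw [hprs] at h; exact absurd h (by simp)
    rw [hprs] at h
    rcases htl' : mvTiles (p :: ps) tl with _ | tl'
    · simp only [htl'] at h; exact absurd h (by simp)
    simp only [htl', Bool.and_eq_true, Nat.ble_eq] at h
    obtain ⟨⟨⟨h1, h2⟩, h3⟩, h4⟩ := h
    have h2 := allOcc_spec h2
    unfold prsOf at hprs
    split at hprs
    · rename_i b a
      rw [← hprs] at h1 h2 htl'
      obtain ⟨hv, hlk⟩ := prs2 a b h1
      obtain ⟨Q, q1, q2, q3, q4⟩ := step_sound (l := 0) W hP htl ![a, b] hv hlk (hocc_of hlk h2) htl'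
      exact (ih _ _ Q q2 q4 h4).step hP q2 q1 q3 (by simp only [costOf] at *; omega)
    · rename_i c b a
      rw [← hprs] at h1 h2 htl'
      obtain ⟨hv, hlk⟩ := prs3 a b c h1
      obtain ⟨Q, q1, q2, q3, q4⟩ := step_sound (l := 1) W hP htl ![a, b, c] hv hlk (hocc_of hlk h2) htl'
      exact (ih _ _ Q q2 q4 h4).step hP q2 q1 q3 (by simp only [costOf] at *; omega)
    · rename_i d c b a
      rw [← hprs] at h1 h2 htl'
      obtain ⟨hv, hlk⟩ := prs4 a b c d h1
      obtain ⟨Q, q1, q2, q3, q4⟩ := step_sound (l := 2) W hP htl ![a, b, c, d] hv hlk (hocc_of hlk h2) htl'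
      exact (ih _ _ Q q2 q4 h4).step hP q2 q1 q3 (by simp only [costOf] at *; omega)
    · exact absurd hprs (by simp)

theorem run_sound (W : Win G U ψ M lo hi) {goals} (hg : ∀ g ∈ goals, Solved G U ψ M lo hi k g)
    {budget : ℕ} (cert : List ℕ) : ∀ (stk : List St), run goals budget cert stk = true →
    ∀ s ∈ stk, ∀ P : V → Fin k, TInv G U P → Sem ψ M lo hi P s → Done G U ψ M lo hi budget P := by
  induction cert with
  | nil =>
    intro stk h s hs
    cases stk with
    | nil => simp at hs
    | cons s stk => exact absurd h (by simp [run])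
  | cons t ts ih =>
    intro stk h s hs P hP hS
    cases stk with
    | nil => simp at hs
    | cons s0 stk =>
      rw [run] at h
      rcases hb : Nat.beq (t % 2) 1 with _ | _
      · simp only [hb, cond_false, Bool.and_eq_true, Bool.not_eq_true'] at h
        obtain ⟨⟨h1, h2⟩, h3⟩ := h
        rcases List.mem_cons.1 hs with rfl | hs
        · obtain ⟨s', h4, h5⟩ := expand_sound W hP hS h1 h2 stk
          exact ih _ h3 s' h4 P hP h5
        · exact ih _ h3 s (expand_sub _ _ _ _ hs) P hP hS
      · simp only [hb, cond_true, Bool.and_eq_true] at h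
        obtain ⟨h1, h2⟩ := h
        rcases List.mem_cons.1 hs with rfl | hs
        · exact runMoves_sound W hg _ _ _ P hP hS.tl h1
        · exact ih _ h2 s hs P hP hS

end sound2

def certV : List ℕ :=
    [160, 224, 235049119, 228, 309476888735, 166, 332298278995090448551, 290, 258583360294290229537,
    264713268122049143148771, 352, 220798062664147786854665318896930014857377,
    220798062664147786854665318896930014857377, 264789360941353195176225,
    277651768938440367847363674531, 277651768938440367847363674531, 290, 258439238339732476193,
    264713268122049143150819, 292, 264641780059886124828961, 284312935512884296114134162178275, 292,
    292, 356877513601065476255572662501, 264641780059886055754017, 309541900447, 290,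
    258439238339732474145, 258439238339732541729, 352, 215628581508372817702880815749831950623,
    215628581508372817702880815749831950623, 264641780059886053654817,
    277497019168075078459411759523, 277497019168075078459411759523, 290, 258439238339732474145,
    332368084789314750821, 228, 240757411999, 166, 258511302700252242087, 240824520863, 292,
    258439238339732476195, 258439238339732543779, 354, 264641780059886055688483,
    273564518426416294035556639, 288, 264641780059886055754019, 277497019168075080660582500773,
    277497019168075080660582500773, 252382068691144995, 252382068691144995, 226, 240755314847,
    240824520863, 226, 254633868504826143, 240822423711, 254633868504826143, 228,
    260817145709465927967, 166, 280050277764555728227309682975, 258581108494476480805, 228,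
    258511302700252367073, 166, 277574397685984967677511567585, 260889203303503855903, 292,
    264787055098343916343651, 264787055098343916343651, 270993182781323318506391777,
    258581108494476480867, 229535, 224, 235112607, 248659279315231, 162, 228, 258439238339732347041,
    252375302140041443, 258439238339732347041, 252375302140039395, 230, 258432309391337494755, 168,
    277489579266387051416750631081, 258432309391402506467, 290, 191519035414335726061855,
    258432309391400470755, 270985917252397002345711973, 270985917252397002345711973,
    246460255996131, 162, 226, 182648913101357215, 252375302140039457, 290,
    200822183542840177315922739487, 270985917252397068917704997, 352,
    205641915947799089473916139569439, 205641915947799089473916139569439,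
    205641915947866177666891074666783, 205641915947868483509900288360735,
    205641915947868483509900288360735, 228, 270985917252394869894385831, 258432309391400407329, 228,
    270985917252394869894385831, 258432309391402436897, 270985917252394869894385831, 230,
    277489579266387051416750623009, 168, 297952166982483014478203606768990521633,
    277489579266456857210974865697, 258432309391400470817, 228, 332298278995090442401, 166,
    356802560200249305271055386785, 290, 271217573765563503427621025, 264713261193238251999393, 352,
    205634220190483878231295681462559, 205634220190483878231295681462559,
    205634220190483878231295681528095, 293735129695661384875111356683225249,
    293735129695661384875111356683225249, 290, 277497019168075080658434885793,
    264713261193238254096545, 292, 284156947628108956906139198654625,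
    291136445965193519220873382070552737, 292, 292, 284233699910616129225992851265765,
    277489579266521836218313119909, 258509044134021599393, 290, 277497019168075078459411630241,
    277497019168075151027179063457, 352, 210574786629270329787969546630824223,
    210574786629270329787969546630824223, 284156947628108880483483998455969,
    297960155516091897313951892636201879713, 297960155516091897313951892636201879713, 290,
    264713261193238319108257, 264713261193238319108257, 226, 252375302140037409, 252375302140037409,
    178361402163359, 246460255996193]

theorem certV_ok : run [((79, 80, 81), 0)] 11 certV
    [St.ini (79, 111, 143)] = true := by
  decide +kernel

def certL : List ℕ :=
    [160, 226, 237146271, 292, 254633868504832291, 166, 230, 260745081348948271395, 232,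
    267002963301258605398247, 170, 286692248828498476456008906682539, 267002963301325177391335,
    205634220122014317957041463988449, 267076757206493114437865, 288,
    205639442485493831581825109299425, 205639442485493831581825109299425, 307394416799, 286,
    264787055098343908014305, 220, 271141944420704161735473377, 330062241780101118239, 309541900447,
    354, 332368084789314816417, 332368084789314816417, 288, 205639442485493831581825109299425,
    205639442485493831581825109299425, 307394416799, 286, 264787055098343908014305, 220,
    271141944420704161735473377, 330062241780101118239, 309541900447, 354, 260745081349013344547,
    210574786629341239079014654332342497, 332368084789314816417, 332368084789314816417,
    254633868504895779, 288, 205639442485493831581825109299425, 205639442485493831581825109299425,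
    307394416799, 286, 264787055098343908014305, 220, 271141944420704161735473377,
    330062241780101118239, 309541900447, 354, 332368084789314816417, 332368084789314816417, 288,
    205639442485493831581825109299425, 205639442485493831581825109299425, 307394416799, 354,
    267224331159082923102437, 267224331159082923102437, 309541900447, 354, 332368084789314816417,
    237146271, 228, 309476888735, 166, 332298278995090448551, 242972004511, 292,
    260745081349078292707, 260889203303503925543, 354, 267152850025797233510689,
    267152850025797233510689, 267002963301454156437731, 267002963301456303921379,
    267002963301456303921379, 205639440067646806294783047469281, 205639440067646806294783047469281,
    228, 242904895647, 166, 260817145709465936039, 242974101663, 228, 352, 264715573965058352711905,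
    264715573965058352711905, 332298278995090506083, 332298278995090506083, 288,
    340273437690972678222179, 288, 220, 282, 327702008033756413165653142042353394605924211255513,
    327702008033756413165653142042353394605924211255513,
    312520988496548093000081197779038805581656289, 348, 348440000195556022499572067,
    348440000195556022499572067, 291057851627979435937090711310401885, 348,
    348440000195556022499572067, 305196277828660247070391794706092583579873, 288,
    340273437690972678224227, 288, 350, 365365821645055351921014250764573,
    348440000195556022501669219, 340273437690972678289763, 288, 292, 168, 232,
    273562157243174932164292775, 322965190586671134920326073478194565388987310309,
    267150544182788019691687, 232, 356, 267076757206493181616483, 267076757206493181614435,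
    286929940755933734132278081396965, 254569299509115931429276882328001585196866563659333955264741,
    254569299509115931429276882328001585196866563659333955264741, 260738152469467730085, 356,
    267076757206493181679971, 273486599379449017971149155, 260817145709465997667,
    260817145709465997667, 340273437690972678226275, 292, 168, 232, 273562157243174932164292775,
    322965190586671134920326073478194565388987310309, 267150544182788019691687, 232, 288, 356,
    267076757206493181616483, 267076757206493181614435, 286929940755933734132278081396965,
    248602831551871026786403205398439048043814932824895824101, 418,
    254569299509115931429276882328001585196866637968727806877925,
    273341703989320444840330686631901788364174903148185355751096330914273, 418,
    266935257802070746914385436163966590199389477889841114779117586917, 356,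
    267076757206493181616483, 267076757206493181614435, 286929940755933734132278081396965,
    348440000195556022503770467, 418, 365365821645055351852844529912289,
    365365821645055351852844529912289, 418, 365365821645055351852844529912289,
    260738152469467730085, 288, 356, 267076757206493181612387, 267076757206493181679971, 418,
    286771484430905133468046605060581, 356, 267076757206493181612387, 267076757206493181679971, 418,
    286771484430905133468046605060581, 260817145709465997667, 260817145709465997667, 166, 352,
    284236183230448667907315147710631, 284236183230448667907315147710631,
    356802560200249305271055450467, 356802560200249305271055450467, 288,
    365365821645055351848446483210407, 288, 220, 282,
    351867351834628094522058373483782693076977042959421711608025,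
    351867351834628094522058373483782693076977042959421711608025,
    335566856226566404840525029643805211140610735850418401, 348,
    374134601364536680292875549366526119, 374134601364536680292875549366526119,
    312520988496548008977582929615888349099434151, 348, 374134601364536680292875549366526119,
    327702008033756254727075224261528526504502671732961, 288, 365365821645055351850645506465959,
    288, 350, 392308563760420414152631745416075860605213, 374134601364536680295127349180211367,
    365365821645055351921014250643623, 292, 260889203303503925481, 260961260897541855461, 356,
    280205020269466468997965123943, 293654000057246856671350471992254631,
    280050277764555728227309752675, 280050277764555728227309752675, 292, 260889203303503925481,
    260961260897541855461, 356, 286771484430905133468046604869799, 280205020269466468997965123943,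
    418, 307918536764027679980943807229904187460069, 280050277764555728227309752675,
    280050277764555728227309752675, 242972004511, 166, 292, 260891455103317610851,
    260891455103317610851, 292, 260891455103317610851, 260891455103317610851, 288, 352,
    297960155516091896982232508673504411933, 220, 282,
    335473311338381626754731351229996522804102551658850521,
    335473311338381626754731351229996522804102551658850521,
    319932280863172175173503257017132304004762857697, 348,
    312433868030441576970041430549755444423194913, 312433868030441576970041430549755444423194913,
    305111199248478102509806088881668446585181, 348, 312433868030441576970041435014828489303224731,
    312433868030441577317874274430793265629655265, 226102955483723535543024671819717930457069923,
    350, 305111199248478102509806088881668517886237, 305111199248478102509806088881668517949725,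
    356, 260961260897541919015, 267002963301454156437731, 260961260897541919015,
    231529429137586640926453476211465008597648705891,
    231529429137586640926453476211465008597648705891, 356, 260961260897541919015,
    226102958142174454029739722862758797458643299, 260961260897541919015,
    226102958142174454029739722862758797458641251, 418,
    231529429137586640926453476211465008597648773475,
    248602831551871026786403205398439048043815003573568571873, 418,
    242776202687374049596096880271913132855288020337068517, 352,
    297960155516091896982232508673504411999, 305111199248478102509806014572274599166307, 356,
    260961260897541919015, 226102958142174454029739722862758797458643299, 260961260897541919015,
    312433868030441576970041358922009189546363235, 418,
    231529429137586640926453476211465008597648773475,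
    327610655603888307012938087973004707937698284210657, 418,
    327610655603888307012938087973004707937698284210657, 277497019168075078150474008801,
    220803667464573765178735031073943291461987, 220803667464573765178735031073943291461987,
    243039113375, 231583]

theorem certL_ok : run [((79, 80, 81), 0), ((79, 111, 143), 11)] 18 certL
    [St.ini (79, 111, 112)] = true := by
  decide +kernel

def certG : List ℕ :=
    [224, 166111, 162, 170103007, 162, 228, 182644512907301031, 174187579615, 182644512907301031,
    174185545951, 230, 187027981217076320423, 168, 200819765691061268237126969513,
    187032489452881811751, 290, 187030305822789110117, 187030305822789110117, 170100959, 162, 228,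
    240757414049, 174187645151, 240757414049, 174185547999, 174185547999, 235114657, 293025, 162,
    226, 174187645151, 182646711930622177, 235112609, 226, 170166495, 162, 226, 290,
    187030233016955017441, 187102433785571154083, 196108074369889873929935011,
    187032559821626050913, 187032559821626050913, 182646711930620129, 290, 187030233016955080929,
    191519033162535981582689, 228, 200814668154767160535505146023, 196115413615986617690067237, 228,
    187028124391719538855, 187032559821626116321, 187028124391719538855, 187030308021812431073,
    187030308021812431073, 290, 182639876725049509, 228, 187023233766450761893,
    196108074369889805210523877, 240889596065, 228, 187023233766450761893, 166,
    200814668154767231080106008743, 187023233766450829477, 252450240559614305, 252450240559614305,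
    226, 191511791376845341233315, 174183514335, 290, 182639876725049573, 174252720351,
    182639876725049573, 174250623199, 174250623199, 178359254614307]

theorem certG_ok : run [((79, 80, 81), 0), ((79, 111, 143), 11), ((79, 111, 112), 18)] 23 certG
    [St.ini (79, 80, 111)] = true := by
  decide +kernel

def certE : List ℕ :=
    [162, 226, 170105057, 170103009, 230, 294, 220800721125133206804969059416667500812455,
    187025485506141261987, 220800721125133206804969059416667500812455, 187025485506139164835, 170,
    296, 296, 191521343511343854362855, 234, 196117855755616106804781287, 191521343511343919374567,
    296, 205644476716801056594966312364201, 191521343511343919374567, 234, 191521343511343854362855,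
    296, 191521343511343854362855, 172, 296, 196117855755616038085304551, 191521343511343919374567,
    296, 196117855755616038085304551, 191521343511343919374567, 296, 356, 182646714078103845, 290,
    187030235215978397989, 290, 352, 226102958142179452763918665965627391646990623,
    226102958142179452763918665965627391646990623, 191518960861161877571877,
    191518960861161879669029, 191518960861161879669029, 210574789105150338973774263603265763,
    220800721125135682685121559082871097104551, 200817085941847430046696182183,
    200817085941847430046696182183, 168, 294, 187032562022796798183, 187032562022796796135,
    237082969041415861717736690121616938323885840115881, 200817085941847430046696057001, 296,
    200824684293751031831021789419, 191521343511343919374567, 356, 182646714078103845, 290,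
    187030235215978397989, 290, 352, 242776202687379416946051869781579476811272205503922463,
    242776202687379416946051869781579476811272205503922463, 191518960861161877571877,
    191518960861161879669029, 191518960861161879669029,
    226102958142179452763918665965627391646869673,
    237082969041418520173807640511365778961920635938985, 215625704149564017468051829416788332967,
    215625704149564017468051829416788332967, 290, 222, 284, 205641915947718455095513695154395,
    205641915947718455095513695154395, 205641915947799089473982703106273, 282,
    210577321930463698017806023768961307, 216, 226105677742651292275424224439871867290147033,
    210577321930463698017806023838228699, 205641915947799089473982705203425, 350,
    215631177656794904689280335759498578143, 226105677742651373979466817349422276571136287, 354,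
    191518960861161877506341, 191518960861161877571877, 191518960861161877506341,
    231532214008475006954974020965736428619597973921,
    231532214008475006954974020965736428619597973921, 220806325920644483117333390429578777164189,
    220806325920644483117333390429578777164189, 191518958609288982204641, 354,
    187030235215978400037, 205639442485498449961670532235491, 187030235215978400037, 356,
    210571976856191666768584734417393831, 191518960861161881768229,
    210571976856191666768584734417393831, 205642075790123297644776260010275,
    205642075790123297644776260010275, 168, 356, 210571976856118470088100254916581543,
    191518960861161881770277, 187025485506074153123, 350, 191518958609289051410657, 222,
    205641915947718529404907546767583, 286, 284149329168849439131588488362143, 222, 284,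
    220806325920557902612718969252058975535391, 210577321930463774110625327890133215,
    205641915947718455095513695224095, 356, 416, 226099938512776890181404229104274472895482147,
    226099938512776890181404229104274472895482147, 191518960861161881768229, 416,
    226099938512776890181404229104274472895482147, 226099938512776890181404229104274472895482147,
    416, 210577485609086256788250890250717475, 210577485609086256788250890250717475,
    191518960861161881833765, 222, 286, 220806325920557982401823063890223140464863, 286,
    284149329168849439131588488362143, 205641915947718529404907546835229, 222, 286,
    220806325920557982401823063890223140464863, 286, 284149329168849439131588488362143,
    205641915947718529404907546835229, 286, 284149329168849439131588488362143, 222,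
    205641915947799089473982772379873, 222, 220806325920644483117333462559740582455519, 222, 286,
    305103018990136800754528799511369123920091, 220806325920557982401823063817588801108317, 286,
    284149329168849439131588488362143, 416, 220806325920557905030570608558427020362211,
    220806325920557905030570608558427020362211, 222, 286,
    220806325920644483117333464811540396140767, 226105677742739950712149391799888667816067359, 286,
    284149329168849439131588488362143, 205641915947799089473982774477025, 416, 356,
    226099938512776890181404229104274472895482147, 191518960861161881768229,
    226099938512776890181404229104274472895482147, 210577485609086256788250890250717475,
    191518960861161881833765, 356, 210574789105150482003594756248344743,
    210574789105150486759644209577498791, 210574789105150482003594756248344743,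
    205639442485498449961670532237539, 168, 358, 187032562022796859625, 296, 187032562022796796137,
    200824684293751029634146085161, 226102958142179611447788223182781820132759975,
    187025485506074153123, 418, 196115566053508088726847715, 352, 205641918365648499421496448813409,
    210577485609086256788319302201014625, 352, 205641918365648499421496448813409, 286,
    312425491445900083972637490701720369177589919, 220806328516790518711700541758431341932831,
    191518958609288984301793, 220806328516790518711700541758431341932831,
    205641918365648499421569528264993, 210574789105150412760750625145587939,
    220803670060722199211016847371784853817829, 220803670060722199211016847371784853817829, 288,
    191518958609289051410657, 222, 205641915947718529404907546767583, 222, 284,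
    220806325920557902612718969252058975471967, 220806325920557902612718969252058975471967,
    210577321930463774110625327888038111, 210577321930463774110625327890135263,
    210577321930463774110625327890135263, 205641915947718455095513695160671, 182646714078103845,
    168, 356, 205636696148555429482625394579623, 187030235215978467621,
    205636696148555429482625394579623, 191519107474128992897251, 191519107474128992897251,
    187025485506074153123, 294, 187032487015729109285, 187032562022796861671, 356,
    182646714078103845, 290, 187030235215978397989, 290, 352,
    215633779152856616254259675245144471779, 215633779152856616254259675245144471779,
    191518960861161877571877, 191518960861161879669029, 191518960861161879669029,
    210579862453961539310800464106586339, 191521266704106608038181, 200824603755525290492497858983,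
    200824603755525290492497858983, 174187647201, 174187647201, 228, 182644515054784679,
    174187579617, 182644515054784679, 230, 187027983416099575975, 168,
    200819768052244509671949576361, 187032489455029295399, 352, 222, 284,
    210577406378505736244652043139313883, 210577406378505736244652043139313883,
    210577406378505736240148443511945565, 282, 215631264131589873914523692174588277019, 216,
    231532306860079087236910689326756943014324885721, 215631264131589873914523692174657544411, 354,
    191519107474128990732577, 191518960861095378911521, 416, 210577485609086254480224250807878045,
    196115566053508086644441377, 205642075790123295320475250885091,
    205642075790123295320475250885091, 196115492264279850055139553, 286, 284,
    205641998416509508053548080001309, 218, 215631264131589873909912006156225902811,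
    215631264131589873914523692174657548575, 222, 191519035414335791071457, 222,
    196115492264279850050945249, 187030378392704092449, 354, 191519107474128990796065, 222, 286,
    196115492264279850050945249, 226105680401193647493892555186277330830332131, 286,
    312425491445900083972713122428983705432520863, 191519035414335791071457, 416,
    196115566053508086577396001, 205642075790123295388644971807203, 354, 191519107474128990798113,
    191519107474128990798113, 187030378392704092449, 230, 294,
    242772960298409842398962370684535744843659100402585827, 191521269201950067757287,
    242772960298409842398962370684535744843659100402585827, 200819768052244509671949637989,
    200819768052244509671949637989, 168, 294, 191516655018086032976039, 191521269201949998489957,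
    260675481208694168477014391606177539261629117300471639126026409,
    215628584043673947109144779756813982053, 215628584043673947109144779756813982053,
    187027983416099641511, 168, 294, 191521269201949998487909, 191521269201949998487909, 294,
    191521269201949998487909, 191521269201949998487909, 191521343511343978090723,
    187032489455029295461, 222, 286, 196115492264279850050945249, 350, 196115492264279850053042401,
    284, 210577406378505736314457837363556571, 210577406378505736240148443511945563, 286,
    196115492264279850120151265, 350, 205641998416509508053548080134365, 284,
    205641998416509508053548080001309, 215631264131589873986004825460282059039, 354,
    205642075790123295390843995060575, 205642075790123295390843995060575, 191519035414335791071457,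
    191519035414335791071457, 354, 354, 226105680401193568265730114783232023045968099,
    191519107474128990863649, 228, 182717082822217895, 174185550049, 228, 288,
    187028054025122844839, 222, 200819843868105945240423395551, 222, 284,
    305103018990134399827922519160947550163111, 305103018990134399827922519160947550163111,
    205639520120940548927336738951335, 205639520120940551179136552636583,
    205639520120940551179136552636583, 290976714371183350364274250400166047, 187028124393867022503,
    196113054738519960083267939, 196113054738519960083267939, 182648913101361379, 292,
    187030310222983106915, 187030310222983106915, 230, 220800721125135682685043016235001013573799,
    168, 237082969041418520173723305770631600956578623367337, 196117777105073262897109287,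
    174185613537, 228, 178361402101925, 166, 187032487015661936867, 294, 166,
    191521266704037823418595, 166, 232, 200817086010876032353296486567,
    200817086010950521817875650793, 166, 232, 205644394245584112740065075241131,
    200817086010876032353294389415, 191521266704037890527459, 166, 232,
    205636696075213334341504666411179, 205636696075213341276977053870311,
    200817086010950521817875650793, 166, 232, 200817086010952780390611589413,
    200817086011024837984649517349, 200817086010952780390611589413, 200817086010876032353292292263,
    200817086010876032353292292263, 196110435557571067986090277, 166, 232, 172, 296,
    210571976781018461467624503161106663, 215625704223682914816911581898168707367, 296,
    210571976781018461467624503161106663, 215625704223682914816911581898168707367,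
    200817086010876032355508981927, 296, 200817086010876032353361498279, 170, 296, 296,
    200817086010876032355508981927, 234, 215625704223682914819287230701606580459,
    200817086010876032422080975015, 296, 226108493338033661904288110035445617122318563,
    200817086010876032422080975015, 234, 200817086010876032355508981927, 296,
    200817086010876032355508981927, 172, 296, 215633862817796160488825216115373480163,
    200817086010876032422080975015, 296, 215633862817796160488825216115373480163,
    200817086010876032422080975015, 296, 356, 182642075817513125, 290, 187025485637196484773, 290,
    352, 226102958142179529588736650836082256742023455,
    226102958142179529588736650836082256742023455, 200817086082501460897850362147,
    200817086082569155805475932513, 200817086082569155805475932513,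
    210574789105150410522461543638335781, 166, 232, 205636696075215647119986267689253,
    205636696075289434096281105895717, 205636696075215647119986267689253,
    210579859707478057661102142087663909, 205644394245584040682471037376873,
    200817086010952773617756573989, 290, 354, 200817086082643465199327476003,
    200817086082569155805475869089, 354, 205639442485498517581635640531175, 187025485637265690789,
    166, 232, 215625704223765322394486720490780332455, 215625704223842693646942056757961527719,
    215625704223765322394486720490780332455, 215625704223682914816907078298541330855,
    205644394245584040682471037376873, 205636696075360985035361019664615, 166, 232,
    187025485570498537637, 187025485570565646501, 187025485570498537637, 191521266704037823420643,
    191521266704037823420643, 182642075752439973, 178361402165413, 166, 230, 187025485570496440485,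
    200824603755453164657871986917, 182642075752437925, 230, 290, 222, 284,
    220803667464573765178735100945708213367003, 220803667464573765178735100945708213367003,
    210574786629270329645857907239319777, 282, 226102955483723535543024743368405210418671899, 216,
    242776199832884111365696218421523314606048567416346841,
    226102955483723535543024743363970020801866011, 210574786629270329645857907241416929, 350,
    237088987144678407121893397468914102906468128037091,
    242776199832884111365696218419256836703384928614973727, 354, 200817086082357165701252614439,
    210577324406424130747689807372392675, 210577324406424130675632213334464739,
    254572361507039544756476406931828812154114789196410556615073,
    254572361507039544756476406931828812154114789196410556615073,
    226102955483723535543024743366221820615555485, 226102955483723535543024743366221820615555485,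
    205639440067646806294783112542433, 354, 187025485637198583973, 191516655018086098108643,
    205641918365648569548038631364835, 356, 200817086082573661604126556451,
    200817086082571409804312875363, 200817086082573661604126556451,
    220803670060796547953207804200358112559395, 220803670060796547953207804200358112559395, 168,
    356, 200817086082571477974033731879, 200817086082571409804312877411,
    196110435557568868962705641, 350, 205639440067646806294783112610017, 222,
    210574786629270329645857907241484513, 286, 220803667464573765178735101018275980867805, 222, 284,
    226102955483723535543024743368546188196606171, 226102955483723535543024743366294388382986525,
    210574786629270329645857907243581665, 356, 416, 205636696148555429482625594001699,
    205636696148555429482625594001699, 200817086082571409804312875363, 416,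
    205636696148555429482625594001699, 205636696148555429482625594001699, 416,
    220803836497893076883357367383949696076063, 220803836497893076883357367383949696076063,
    205639442485498519972216211608035, 222, 286, 226102955483723535543024743366294388382988571, 286,
    312425491445900083972637490699641982768421091, 220803667464573765178735101018275980867869, 222,
    286, 237086132649300890005562713380187909032453689600223, 286,
    312425491445900083972637490699641982768421091, 220803667464573765178735101018275980867869, 286,
    312425491445900083972637490699641982768421091, 222, 210574786629270329645857907308593377, 222,
    226102955483723535543024743438351982420846815, 222, 286,
    335464317049217153486532945354616618724741030776961243,
    226102955483723535543024743366294388382988637, 286,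
    312425491445900083972637490699641982768421091, 416,
    237086132649300890165566194922960180767323979221283,
    237086132649300890165566194922960180767323979221283, 222, 286,
    226102955483723535543024743440603782234532063, 231529426415332900396057337207011144310328754463,
    286, 312425491445900083972637490699641982768421091, 210574786629270329645857907310690529, 416,
    356, 205636696148555429482625594001699, 200817086082571409804312875363,
    205636696148555429482625594001699, 226102958142255665104084791501166707261016355,
    205639442485498519972216211608035, 356, 200819768052244646075816055079,
    191516655018086100207843, 200819768052244646075816055079, 191516655018086098110691, 168, 358,
    187025485570630721701, 296, 187025485570565709989, 200817086011094711948594751785,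
    205639442485498522226215048550823, 196110435557568868962705641, 418,
    215631345263704326951238965453578868963, 352, 220806497550033000955848011538406893324641,
    231532393975023645017315685825998762087115290977, 352,
    220806497550033000955848011538406893324641, 286, 312433868030441577317874274214306332566386847,
    237089171430423965706525987376022063692572378099999, 210577321930463700323649032928139491,
    237089171430423965706525987376022063692572378099999, 220806497550033000955848011538479972776225,
    231529429137591840759891201897434990695105730787, 205639442485498519974415234927077,
    205639442485498519974415234927077, 288, 210577321930463774110625327766345955, 222,
    226105677742651373979466817216434150463271135, 222, 284,
    312433868030441577317874274214306332495014047, 312433868030441577317874274214306332495014047,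
    226102955483723535543024743363970020801808735, 231532214008475006954974020965736353614610602211,
    231532214008475006954974020965736353614610602211, 305111199248478102849486595912408527827103,
    196115566053507884585947363, 168, 356, 187025485637200681125, 187025485637267789989,
    187025485637200681125, 210577485609086037593696605242233251,
    210577485609086037593696605242233251, 196110435557568868962705641, 166, 230, 294,
    200817086011022654354556692647, 200817086011094709749571360939, 200817086011022654354556692647,
    200817086010950528590797904229, 200817086010950528590797904229, 196110435557639237706948775,
    294, 205644394245584040609660912574693, 210579859707478057658850342206740837, 232,
    205636696075287195807266235457707, 200817086011022579411915677863, 232,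
    200817086010952780390611654885, 200817086011024837984649582821, 200817086010952780390611654885,
    205644394245584040684670060697829, 200817086011022579411915741351, 294, 187025485570563610789,
    232, 200817086011022652155533502697, 200817086011022652155533502697, 187025485570630719653, 232,
    200817086011022654354556690601, 170, 215625704223840348991983243676247896235,
    200817086011022579411980691625, 196110435557568868962834789, 196110435557568868962834789, 230,
    196110435557639237707014311, 187025485570630721701, 168, 294, 187025485570563612837,
    187025485570630721701, 187025485570563612837, 296, 200817086011024906154370439525, 234,
    215625704223842766843622547772255017317, 200817086011094711948594684265, 234,
    220800721125133214251875763336251324012901, 215625704223762897270407727520690772325,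
    220800721125133214251875763336251324012901, 200817086011024906154370439525, 296,
    220800721125133206804897510872572848544101, 200817086011094711948594684327, 296,
    200817086011094711948594684327, 294, 187025485570563612837, 187025485570630721701,
    187025485570563612837, 210571976781018454365771213477945577,
    210571976781018454365771213477945577, 182642075752503461, 226, 170100961, 170168545, 288,
    174183448801, 222, 187028054025122902239, 222, 284, 284149329168847203094440064542879,
    284149329168847203094440064542879, 191516727321725849925855, 191516727321725852023007,
    191516727321725852023007, 277489579266452346771914125471, 174183514337, 182644515054846307,
    182644515054846307, 166113, 166113]

theorem certE_ok : run [((79, 80, 81), 0), ((79, 111, 143), 11), ((79, 111, 112), 18), ((79, 80, 111), 23)] 16 certE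
    [St.ini (79, 80, 112)] = true := by
  decide +kernel

def certJ : List ℕ :=
    [224, 229535, 162, 228, 258439238339732347041, 252375302140041443, 258439238339732347041,
    252375302140039395, 230, 258432309391337494755, 168, 277489579266387051416750631081,
    258432309391402506467, 290, 300124319, 286, 196115492264279783487338717,
    196115492264279783487338717, 196115492264279783487404253, 307459491999, 307459491999,
    258432309391400470755, 270985917252397002345711973, 270985917252397002345711973,
    246460255996131, 290, 246460255996193, 162, 252375302140039457, 162, 228,
    270985917252394869894385831, 258432309391400407329, 252375302140037409, 286, 293085, 293085,
    298090655, 284, 300183773, 218, 322319870882767067, 300247261, 300187807, 352,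
    322324202357359007, 322324202357359007, 226, 258509044134021599393, 162, 226,
    270985917252397068917704935, 228, 264713261193238184890529, 277497019168075082857458141345, 226,
    258509044134021664929, 226, 228, 270985917252467437661819045, 166,
    284149329168851819600408106737891, 277497019168075080658434885793, 252375302140104993, 162, 162,
    258432309391402504481, 162, 226, 277571972568960922955307784355, 228, 264713261193238184890529,
    166, 284233699910615985110804775280807, 264713261193238254096545, 226, 258509044134021664929,
    286, 293085, 293085, 298090655, 307459555487, 307459555487, 286, 293085, 293085, 298090655, 284,
    300183773, 218, 322319870882767067, 300247261, 300187807, 352, 322324202357359007,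
    322324202357359007, 286, 293085, 293085, 298090655, 352, 307524567199, 330132183913767207331,
    300187807, 352, 322324202357359007, 160, 160, 235049119, 160, 290, 252382068691144993, 228,
    258439238339801678053, 258439238339732478241, 228, 284149329168851819600408106731681, 166,
    290968913068904263270817901299599521, 258439238339732476193, 228, 264713261193169530491045, 166,
    284233699910542268010677200461991, 264713268122049143150819, 286, 293085, 293085,
    320072402543544481, 330132183913767078049, 330132183913767078049, 228, 292,
    305103018990136875708003404784730479233185, 277497019168149385589815613731, 166, 292,
    264641780059886059884833, 277497019168075082857458276643, 264713268122049143148771, 292,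
    258439238339732541729, 286, 293085, 293085, 320072402543544481, 352, 330201989707991320737,
    354476733316671721094410240419, 322324202357229729, 352, 346092976958396947730104735, 160, 228,
    240757411999, 166, 258511302700252242087, 240824520863, 292, 258439238339732476195,
    258439238339732543779, 288, 235176157, 354, 291136445965193519220873382072776929,
    264641780059886055754019, 277497019168075080660582500773, 277497019168075080660582500773, 354,
    277497019168075080660582500773, 277497019168075080660582500773, 286, 293085, 293085,
    264641780059886055688483, 354, 277497019168075080660582500773, 252382068691144995,
    252382068691144995, 160, 226, 307327307935, 240822423711, 307327307935, 228,
    329990177419579068581, 166, 354324255004582442409310527655, 258581108494476480805, 352,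
    346168684879562227832879265, 346168684879562227832879265, 228, 264715573965058419820769, 166,
    284236183230448739964909185638567, 329990184186063130851, 292, 264787055098343916343651,
    264787055098343916343651, 277497019168075078150541117665, 258581108494476480867, 350,
    307459619037, 284, 330132252150060116253, 330132252150060116253,
    371695795114262366834779348099498397, 228, 264715573965058421917921, 166,
    284236183230448742216708999323815, 329990184186063130851, 292, 264787055098343916343651,
    264787055098343916343651, 277497019168075078150543214817, 258581108494476480867, 228, 292, 168,
    232, 371535917634068738475423314408087725,
    438632191154335935833260251097924698369326415732137042149, 346019787373085262696652967, 232,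
    170, 356, 362828037124692421027134043431267, 362828037124692421027134043429219,
    371535917634068888357463937977196773, 271068747740219824111192289, 418,
    284236183230448742216708999514593, 284236183230448742216708999514593, 418,
    284236183230448742216708999514593, 371535917634068738475423314408024299,
    337909941677649100509349, 350, 235239645, 284, 235172061, 252586644426025245, 414,
    291057851627979509791764177291213281, 291057851627979509791764177291213281,
    284236183230448744325332152514847, 356, 271068747740219824111192289,
    362828037124692421027134043494755, 418, 284236183230448742216708999514593,
    271068747740219822028720353, 354324255004582442409310589283, 354324255004582442409310589283,
    166, 292, 337909948606528645996771, 264787055098343916345699, 356,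
    291057851627979512102110786132091047, 284312935512884296116333185438055, 418,
    305196277828660244806274924211166811425249, 380452771856061480070948040545608700259,
    380452771856061480070948040545608700259, 329990184186063130851, 292, 264787055098343916343651,
    264787055098343916343651, 350, 235239645, 284, 235172061, 252586644426025245, 284, 235172061,
    218, 252514076658524379, 240885524701, 290976714371183493470656009792289055, 284, 235172061,
    218, 252514076658524379, 348, 343524670810502785414398652199321075322960770238763069661, 218,
    282, 405562347868586678291360605918739344267140055904006682892104432709171593636055,
    368856806625068819167937004675640622978917286516614373920567814427, 282,
    377709369984070470827967492787855997930411301463848615896054015224029, 356,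
    337909948606528713169123, 264787055098343916411235, 337909948606528713169123,
    264787055098343916409187, 418, 271141944420704170403139939,
    291136445965193519293001724588362209, 418, 284312935512884296184502906423781,
    284156947628108880026154236741857, 258581108494476480867, 300124319, 160, 226, 240755314847,
    240824520863, 235112607, 286, 293085, 293085, 235239645, 284, 300183773, 218,
    322319870882767067, 300247261, 160, 226, 329990184186063124833, 240822423711,
    329990184186063124833, 228, 264787124904138138423461, 166, 284313010466285109898770425028775,
    258581108494476480805, 338055356327697488117921, 307459491999]

theorem certJ_ok : run [((79, 80, 81), 0), ((79, 111, 143), 11), ((79, 111, 112), 18), ((79, 80, 111), 23), ((79, 80, 112), 16)] 26 certJ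
    [St.ini (79, 110, 111)] = true := by
  decide +kernel

section corner
variable {V : Type*} {G : SimpleGraph V} {U : Set V} {ψ : ℕ → V} {M lo hi k : ℕ}

theorem solved_of (W : Win G U ψ M lo hi) {goals} (hg : ∀ g ∈ goals, Solved G U ψ M lo hi k g)
    {w : ℕ} {cert : List ℕ} {t : ℕ × ℕ × ℕ} (h : run goals w cert [St.ini t] = true)
    (hini : addTile ⟨[], 3, 22, 0, 5, 6, 10⟩ t [] = [St.ini t])
    (hne : t.1 ≠ t.2.1 ∧ t.1 ≠ t.2.2 ∧ t.2.1 ≠ t.2.2) : Solved G U ψ M lo hi k (t, w) := by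
  refine ⟨hne, fun P hP hS => ?_⟩
  have h0 : Sem ψ M lo hi P ⟨[], 3, 22, 0, 5, 6, 10⟩ :=
    ⟨W.hM, W.hM', Nat.zero_le _, W.hlo, W.hhi, W.hhi', by simp⟩
  obtain ⟨s, h1, h2⟩ := addTile_sound W h0 hS (x := t.1) (Or.inl rfl) rfl []
  rw [hini] at h1
  exact run_sound W hg cert _ h s h1 P hP h2

theorem solved_H : Solved G U ψ M lo hi k ((79, 80, 81), 0) :=
  ⟨by decide, fun P hP hS => ⟨P, 0, le_rfl, Reach.refl P, hP, fun _ _ => rfl, hS⟩⟩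

theorem corner (W : Win G U ψ M lo hi) {P : V → Fin k} (hP : TInv G U P) :
    Done G U ψ M lo hi 28 P := by
  have sH : Solved G U ψ M lo hi k ((79, 80, 81), 0) := solved_H
  have sV : Solved G U ψ M lo hi k ((79, 111, 143), 11) :=
    solved_of W (by simpa using sH) certV_ok rfl (by decide)
  have sL : Solved G U ψ M lo hi k ((79, 111, 112), 18) :=
    solved_of W (by simpa using ⟨sH, sV⟩) certL_ok rfl (by decide)
  have sG : Solved G U ψ M lo hi k ((79, 80, 111), 23) :=
    solved_of W (by simpa using ⟨sH, sV, sL⟩) certG_ok rfl (by decide)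
  have sE : Solved G U ψ M lo hi k ((79, 80, 112), 16) :=
    solved_of W (by simpa using ⟨sH, sV, sL, sG⟩) certE_ok rfl (by decide)
  have sJ : Solved G U ψ M lo hi k ((79, 110, 111), 26) :=
    solved_of W (by simpa using ⟨sH, sV, sL, sG, sE⟩) certJ_ok rfl (by decide)
  have hlo := W.hlo
  have hhi := W.hhi
  have hM := W.hM
  obtain ⟨t, ht, hS, _⟩ := cands_sound W hP (x := 79)
    ⟨by decide, by omega, by omega, by omega⟩ (by decide)
  have hpos : posOk t.1 = true ∧ posOk t.2.1 = true ∧ posOk t.2.2 = true :=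
    ⟨(hS.1 _ (Or.inl rfl)).1, (hS.1 _ (Or.inr (Or.inl rfl))).1, (hS.1 _ (Or.inr (Or.inr rfl))).1⟩
  have key : ∀ t ∈ cands 79, posOk t.1 = true ∧ posOk t.2.1 = true ∧ posOk t.2.2 = true →
      t = (79, 80, 81) ∨ t = (79, 111, 143) ∨ t = (79, 111, 112) ∨ t = (79, 80, 111) ∨
      t = (79, 80, 112) ∨ t = (79, 110, 111) := by decide +kernel
  rcases key t ht hpos with rfl | rfl | rfl | rfl | rfl | rfl
  · exact (sH.2 P hP hS).mono (by omega)
  · exact (sV.2 P hP hS).mono (by omega)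
  · exact (sL.2 P hP hS).mono (by omega)
  · exact (sG.2 P hP hS).mono (by omega)
  · exact (sE.2 P hP hS).mono (by omega)
  · exact (sJ.2 P hP hS).mono (by omega)

end corner

/-! ### The sweep -/

structure Grid {V : Type*} (G : SimpleGraph V) (R C : V → ℕ) (m q : ℕ) : Prop where
  hR : ∀ v, R v < m
  hC : ∀ v, C v < 3 * q
  surj : ∀ r c, r < m → c < 3 * q → ∃ v, R v = r ∧ C v = c
  inj : ∀ u v, R u = R v → C u = C v → u = v
  adj : ∀ u v, G.Adj u v ↔ (R u = R v ∧ (C u = C v + 1 ∨ C v = C u + 1)) ∨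
    (C u = C v ∧ (R u = R v + 1 ∨ R v = R u + 1))

theorem lex_le {q r t r0 t0 : ℕ} (ht : t < q) (ht0 : t0 < q) :
    r0 * q + t0 ≤ r * q + t ↔ r0 < r ∨ (r = r0 ∧ t0 ≤ t) := by
  rcases lt_trichotomy r0 r with h | h | h
  · have : (r0 + 1) * q ≤ r * q := Nat.mul_le_mul_right q h
    rw [add_mul] at this
    constructor
    · intro; left; exact h
    · intro; omega
  · subst h
    constructor
    · intro h; right; exact ⟨rfl, by omega⟩
    · rintro (h | ⟨_, h⟩)
      · omega
      · omega
  · have : (r + 1) * q ≤ r0 * q := Nat.mul_le_mul_right q h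
    rw [add_mul] at this
    constructor
    · intro; omega
    · rintro (h | ⟨h, _⟩) <;> omega

theorem lex_eq {q r t r0 t0 : ℕ} (ht : t < q) (ht0 : t0 < q) :
    r * q + t = r0 * q + t0 ↔ (r = r0 ∧ t = t0) := by
  constructor
  · intro h
    have h1 := (lex_le ht ht0).1 h.ge
    have h2 := (lex_le ht0 ht).1 h.le
    omega
  · rintro ⟨rfl, rfl⟩; rfl

section sweep
variable {V : Type*} {G : SimpleGraph V} {R C : V → ℕ} {m q k : ℕ}

def IsSwept (G : SimpleGraph V) (R C : V → ℕ) (q b : ℕ) (P : V → Fin k) : Prop :=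
  Good G P ∧ ∀ u, R u * q + C u / 3 < b → ∀ w, P u = P w ↔ R u * q + C u / 3 = R w * q + C w / 3

theorem window (hG : Grid G R C m q) {r0 j0 : ℕ} (hr : r0 < m) (hj : j0 < q) :
    ∃ ψ : ℕ → V,
      (∀ x, InW (2 + min (m - r0) 20) (5 - min j0 5) (5 + min (q - j0) 5) x →
        R (ψ x) + 2 = r0 + x / 32 ∧ C (ψ x) + 15 = 3 * j0 + x % 32) ∧
      Win G {v | r0 * q + j0 ≤ R v * q + C v / 3} ψ
        (2 + min (m - r0) 20) (5 - min j0 5) (5 + min (q - j0) 5) := by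
  have hq : ∀ v, C v / 3 < q := fun v => by have := hG.hC v; omega
  have hU : ∀ v, r0 * q + j0 ≤ R v * q + C v / 3 ↔ r0 < R v ∨ (R v = r0 ∧ j0 ≤ C v / 3) :=
    fun v => lex_le (hq v) hj
  have hpos : ∀ x, posOk x = true ↔ 96 ≤ x ∨ (64 ≤ x ∧ 5 ≤ x % 32 / 3) := by
    intro x
    simp [posOk]
  obtain ⟨v0, -⟩ := hG.surj r0 (3 * j0) hr (by omega)
  have hex : ∀ x, ∃ v, InW (2 + min (m - r0) 20) (5 - min j0 5) (5 + min (q - j0) 5) x →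
        R v + 2 = r0 + x / 32 ∧ C v + 15 = 3 * j0 + x % 32 := by
    intro x
    by_cases hx : InW (2 + min (m - r0) 20) (5 - min j0 5) (5 + min (q - j0) 5) x
    · obtain ⟨h1, h2, h3, h4⟩ := hx
      rw [hpos] at h1
      obtain ⟨v, e1, e2⟩ := hG.surj (r0 + x / 32 - 2) (3 * j0 + x % 32 - 15) (by omega) (by omega)
      refine ⟨v, fun _ => ?_⟩
      omega
    · exact ⟨v0, fun h => absurd h hx⟩
  choose ψ hψ using hex
  refine ⟨ψ, hψ, ?_⟩
  refine ⟨by omega, by omega, by omega, by omega, by omega, ?_, ?_, ?_, ?_⟩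
  · intro x y hx hy he
    have e1 := hψ x hx
    have e2 := hψ y hy
    rw [he] at e1
    omega
  · intro x y hx hy he
    rw [hG.adj]
    have e1 := hψ x hx
    have e2 := hψ y hy
    obtain ⟨-, -, h3, h4⟩ := hx
    obtain ⟨-, -, h3', h4'⟩ := hy
    rw [adjB_iff] at he
    rcases he with he | he | he | he <;> omega
  · intro x hx
    have e1 := hψ x hx
    obtain ⟨h1, h2, h3, h4⟩ := hx
    rw [hpos] at h1
    show r0 * q + j0 ≤ R (ψ x) * q + C (ψ x) / 3
    rw [hU]
    omega
  · intro x w hx a1 a2 a3 hw hadj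
    have hw' := (hU w).1 hw
    have e1 := hψ x hx
    have hRw := hG.hR w
    have hCw := hG.hC w
    rw [hG.adj] at hadj
    obtain ⟨h1, h2, h3, h4⟩ := hx
    rw [hpos] at h1
    have fin : ∀ y, y / 32 = R w + 2 - r0 → y % 32 = C w + 15 - 3 * j0 → r0 ≤ R w →
        3 * j0 ≤ C w + 15 → C w + 15 - 3 * j0 < 30 → R w + 2 - r0 < 22 → adjB x y = true →
        ∃ y, InW (2 + min (m - r0) 20) (5 - min j0 5) (5 + min (q - j0) 5) y ∧ adjB x y = true ∧
          w = ψ y := by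
      intro y b1 b2 b3 b4 b5 b6 b7
      have hy : InW (2 + min (m - r0) 20) (5 - min j0 5) (5 + min (q - j0) 5) y := by
        refine ⟨?_, ?_, ?_, ?_⟩
        · rw [hpos]; omega
        · omega
        · omega
        · omega
      refine ⟨y, hy, b7, ?_⟩
      have e2 := hψ y hy
      exact hG.inj _ _ (by omega) (by omega)
    rcases hadj with ⟨c1, c2 | c2⟩ | ⟨c1, c2 | c2⟩
    · exact fin (x - 1) (by omega) (by omega) (by omega) (by omega) (by omega) (by omega)
        (by rw [adjB_iff]; omega)
    · exact fin (x + 1) (by omega) (by omega) (by omega) (by omega) (by omega) (by omega)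
        (by rw [adjB_iff]; omega)
    · exact fin (x - 32) (by omega) (by omega) (by omega) (by omega) (by omega) (by omega)
        (by rw [adjB_iff]; omega)
    · exact fin (x + 32) (by omega) (by omega) (by omega) (by omega) (by omega) (by omega)
        (by rw [adjB_iff]; omega)

theorem sweep_step (hG : Grid G R C m q) {b : ℕ} (hb : b < m * q) {P : V → Fin k}
    (hP : IsSwept G R C q b P) :
    ∃ Q w, w ≤ 28 ∧ Reach G w P Q ∧ IsSwept G R C q (b + 1) Q := by
  have hq0 : 0 < q := by
    rcases Nat.eq_zero_or_pos q with h | h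
    · subst h; simp at hb
    · exact h
  have hj : b % q < q := Nat.mod_lt _ hq0
  have hr : b / q < m := by rw [Nat.div_lt_iff_lt_mul hq0]; exact hb
  have hbe : b / q * q + b % q = b := by rw [mul_comm]; exact Nat.div_add_mod b q
  have hq : ∀ v, C v / 3 < q := fun v => by have := hG.hC v; omega
  obtain ⟨ψ, hψ, W⟩ := window hG hr hj
  have hU : ∀ v, b / q * q + b % q = R v * q + C v / 3 ↔ (b / q = R v ∧ b % q = C v / 3) :=
    fun v => lex_eq hj (hq v)
  rw [hbe] at W
  have hU : ∀ v, b = R v * q + C v / 3 ↔ (b / q = R v ∧ b % q = C v / 3) := by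
    intro v; rw [← hU v, hbe]
  have hinv : TInv G {v | b ≤ R v * q + C v / 3} P := by
    refine ⟨hP.1, fun u w hu he => ?_⟩
    by_contra hw
    have hw' : R w * q + C w / 3 < b := not_le.1 hw
    have := (hP.2 w hw' u).1 he.symm
    have hu' : b ≤ R u * q + C u / 3 := hu
    omega
  obtain ⟨Q, w, hw, hreach, hQ, hoff, hS⟩ := corner W hinv
  refine ⟨Q, w, hw, hreach, hQ.good, ?_⟩
  obtain ⟨s1, lab, s2⟩ := hS
  have e79 := hψ 79 (s1 79 (Or.inl rfl))
  have e80 := hψ 80 (s1 80 (Or.inr (Or.inl rfl)))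
  have e81 := hψ 81 (s1 81 (Or.inr (Or.inr rfl)))
  have hblk : ∀ w, Q w = lab ↔ b = R w * q + C w / 3 := by
    intro w
    rw [s2, hU]
    constructor
    · rintro ⟨y, rfl | rfl | rfl, rfl⟩ <;> dsimp only <;> omega
    · rintro ⟨h1, h2⟩
      have : C w = 3 * (b % q) ∨ C w = 3 * (b % q) + 1 ∨ C w = 3 * (b % q) + 2 := by omega
      rcases this with h | h | h
      · exact ⟨79, Or.inl rfl, hG.inj _ _ (by omega) (by omega)⟩
      · exact ⟨80, Or.inr (Or.inl rfl), hG.inj _ _ (by omega) (by omega)⟩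
      · exact ⟨81, Or.inr (Or.inr rfl), hG.inj _ _ (by omega) (by omega)⟩
  intro u hu w
  rcases Nat.lt_or_ge (R u * q + C u / 3) b with h | h
  · have hu' : Q u = P u := hoff u (by simpa using h)
    by_cases hw : b ≤ R w * q + C w / 3
    · constructor
      · intro he
        have := hQ.closed w u hw he.symm
        have : b ≤ R u * q + C u / 3 := this
        omega
      · intro he; omega
    · rw [hu', hoff w hw]
      exact hP.2 u h w
  · have h' : b = R u * q + C u / 3 := by omega
    rw [(hblk u).2 h', ← h', eq_comm, hblk]

theorem sweep (hG : Grid G R C m q) {P : V → Fin k} (hP : Good G P) (b : ℕ) (hb : b ≤ m * q) :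
    ∃ Q w, w ≤ 28 * b ∧ Reach G w P Q ∧ IsSwept G R C q b Q := by
  induction b with
  | zero => exact ⟨P, 0, le_rfl, Reach.refl P, hP, fun u hu => absurd hu (Nat.not_lt_zero _)⟩
  | succ b ih =>
    obtain ⟨Q, w, h1, h2, h3⟩ := ih (by omega)
    obtain ⟨Q', w', g1, g2, g3⟩ := sweep_step hG (by omega) h3
    exact ⟨Q', w + w', by omega, h2.trans g2, g3⟩

theorem sweep_all (hG : Grid G R C m q) {P : V → Fin k} (hP : Good G P) :
    ∃ Q w, w ≤ 28 * (m * q) ∧ Reach G w P Q ∧ Good G Q ∧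
      ∀ u w, Q u = Q w ↔ R u * q + C u / 3 = R w * q + C w / 3 := by
  obtain ⟨Q, w, h1, h2, h3, h4⟩ := sweep hG hP (m * q) le_rfl
  refine ⟨Q, w, h1, h2, h3, fun u => h4 u ?_⟩
  have := hG.hR u
  have h5 := hG.hC u
  have : (R u + 1) * q ≤ m * q := Nat.mul_le_mul_right q this
  rw [add_mul] at this
  omega

end sweep


/-! ### From tilings to balanced partitions -/

/-- Chains of a given length. -/
inductive Chn {α : Type*} (r : α → α → Prop) : ℕ → α → α → Prop
  | refl (a) : Chn r 0 a a
  | step {a b c : α} {n : ℕ} : r a b → Chn r n b c → Chn r (n + 1) a c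

theorem Chn.trans {α : Type*} {r : α → α → Prop} {a b c : α} {n n' : ℕ}
    (h : Chn r n a b) (h' : Chn r n' b c) : Chn r (n + n') a c := by
  induction h with
  | refl a => simpa using h'
  | step a _ ih => rw [Nat.add_right_comm]; exact Chn.step a (ih h')

theorem Chn.exists_fun {α : Type*} {r : α → α → Prop} {a b : α} {n : ℕ}
    (h : Chn r n a b) : ∃ c : ℕ → α, c 0 = a ∧ c n = b ∧ ∀ i < n, r (c i) (c (i + 1)) := by
  induction h with
  | refl a => exact ⟨fun _ => a, rfl, rfl, by simp⟩
  | @step a b d n hr _ ih =>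
    obtain ⟨c, h0, h1, h2⟩ := ih
    refine ⟨fun i => if i = 0 then a else c (i - 1), by simp, by simpa using h1, ?_⟩
    intro i hi
    rcases i with _ | i
    · simpa [h0] using hr
    · simpa using h2 i (by omega)

theorem Reach.symm {V : Type*} {G : SimpleGraph V} {k : ℕ} {P Q : V → Fin k} {c : ℕ}
    (h : Reach G c P Q) : Reach G c Q P := by
  induction h with
  | refl P => exact Reach.refl P
  | @step P Q R l c a b m _ ih =>
    have h1 : Reach G (l + 2 + 0) Q P := Reach.step b a (move_symm a m) (Reach.refl P)
    have := ih.trans h1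
    rwa [show l + 2 + c = c + (l + 2 + 0) by omega]

theorem conn_three {V : Type*} {G : SimpleGraph V} {a b c : V} (h1 : G.Adj a b) (h2 : G.Adj b c)
    {s : Set V} (hs : ∀ u, u ∈ s ↔ u = a ∨ u = b ∨ u = c) : (G.induce s).Connected := by
  have e : s = {a, b} ∪ {b, c} := by
    ext u; simp only [hs, Set.mem_union, Set.mem_insert_iff, Set.mem_singleton_iff]; tauto
  rw [e]
  apply induce_union_connected (induce_pair_connected_of_adj h1).preconnected
    (induce_pair_connected_of_adj h2).preconnected
  exact ⟨b, by simp, by simp⟩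

theorem path_of_conn {V : Type*} {G : SimpleGraph V} {s : Set V} (hc : (G.induce s).Connected)
    (h3 : s.ncard = 3) : ∃ a b c, a ≠ c ∧ G.Adj a b ∧ G.Adj b c ∧ ∀ u, u ∈ s ↔ u = a ∨ u = b ∨ u = c := by
  obtain ⟨x, y, z, hxy, hxz, hyz, rfl⟩ := Set.ncard_eq_three.1 h3
  have hn : Nontrivial ({x, y, z} : Set V) :=
    ⟨⟨x, by simp⟩, ⟨y, by simp⟩, fun h => hxy (congrArg Subtype.val h)⟩
  have key : ∀ u ∈ ({x, y, z} : Set V), ∃ w ∈ ({x, y, z} : Set V), G.Adj u w := by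
    intro u hu
    obtain ⟨w, hw⟩ := hc.preconnected.exists_adj_of_nontrivial ⟨u, hu⟩
    exact ⟨w.1, w.2, hw⟩
  have kx : G.Adj x y ∨ G.Adj x z := by
    obtain ⟨w, hw, h⟩ := key x (by simp)
    rcases hw with rfl | rfl | rfl
    · exact absurd h (G.loopless.irrefl _)
    · exact Or.inl h
    · exact Or.inr h
  have ky : G.Adj x y ∨ G.Adj y z := by
    obtain ⟨w, hw, h⟩ := key y (by simp)
    rcases hw with rfl | rfl | rfl
    · exact Or.inl h.symm
    · exact absurd h (G.loopless.irrefl _)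
    · exact Or.inr h
  have kz : G.Adj x z ∨ G.Adj y z := by
    obtain ⟨w, hw, h⟩ := key z (by simp)
    rcases hw with rfl | rfl | rfl
    · exact Or.inl h.symm
    · exact Or.inr h.symm
    · exact absurd h (G.loopless.irrefl _)
  have c1 : G.Adj x y → G.Adj y z → ∃ a b c, a ≠ c ∧ G.Adj a b ∧ G.Adj b c ∧
      ∀ u, u ∈ ({x, y, z} : Set V) ↔ u = a ∨ u = b ∨ u = c :=
    fun h h' => ⟨x, y, z, hxz, h, h', fun u => by simp⟩
  have c2 : G.Adj x y → G.Adj x z → ∃ a b c, a ≠ c ∧ G.Adj a b ∧ G.Adj b c ∧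
      ∀ u, u ∈ ({x, y, z} : Set V) ↔ u = a ∨ u = b ∨ u = c :=
    fun h h' => ⟨y, x, z, hyz, h.symm, h', fun u => by
      simp only [Set.mem_insert_iff, Set.mem_singleton_iff]; exact or_left_comm⟩
  have c3 : G.Adj x z → G.Adj y z → ∃ a b c, a ≠ c ∧ G.Adj a b ∧ G.Adj b c ∧
      ∀ u, u ∈ ({x, y, z} : Set V) ↔ u = a ∨ u = b ∨ u = c :=
    fun h h' => ⟨x, z, y, hxy, h, h'.symm, fun u => by
      simp only [Set.mem_insert_iff, Set.mem_singleton_iff]; exact or_congr_right or_comm⟩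
  rcases kx with h | h
  · rcases kz with h' | h'
    · exact c2 h h'
    · exact c1 h h'
  · rcases ky with h' | h'
    · exact c2 h' h
    · exact c3 h h'

theorem finsum_one_set {V : Type*} [Fintype V] (s : Set V) :
    ∑ᶠ v ∈ s, (1 : ℝ) = s.ncard := by
  rw [finsum_mem_eq_finite_toFinset_sum _ (Set.toFinite s), Finset.sum_const,
    Set.ncard_eq_toFinset_card s (Set.toFinite s)]
  simp

theorem total_div {V : Type*} [Fintype V] {k : ℕ} (hk : 0 < k) (hV : Fintype.card V = 3 * k) :
    (∑ᶠ _v : V, (1 : ℝ)) / k = 3 := by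
  rw [finsum_eq_sum_of_fintype]
  have : (k : ℝ) ≠ 0 := by exact_mod_cast hk.ne'
  simp [hV]
  field_simp

theorem Good.ncard {V : Type*} {G : SimpleGraph V} {k : ℕ} {P : V → Fin k} (h : Good G P)
    (i : Fin k) : (P ⁻¹' {i}).ncard = 3 := by
  obtain ⟨a, b, c, h1, h2, h3, h4⟩ := h i
  have : P ⁻¹' {i} = {a, b, c} := by ext u; simpa using h4 u
  rw [this]
  exact Set.ncard_eq_three.2 ⟨a, b, c, h2.ne, h1, h3.ne, rfl⟩

theorem balanced_iff {V : Type*} [Fintype V] {G : SimpleGraph V} {k : ℕ}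
    (hV : Fintype.card V = 3 * k) (P : V → Fin k) :
    IsBalancedPartition G (fun _ => (1 : ℝ)) k P ↔ Good G P := by
  unfold IsBalancedPartition
  constructor
  · rintro ⟨h1, h2⟩ i
    have hk : 0 < k := i.pos
    have := h2 i
    rw [total_div hk hV, finsum_one_set] at this
    exact path_of_conn (h1 i) (by exact_mod_cast this)
  · intro h
    refine ⟨fun i => ?_, fun i => ?_⟩
    · obtain ⟨a, b, c, h1, h2, h3, h4⟩ := h i
      exact conn_three h2 h3 h4
    · rw [total_div i.pos hV, finsum_one_set, h.ncard]
      norm_num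

theorem move_step {V : Type*} {G : SimpleGraph V} {k l : ℕ} {P Q : V → Fin k}
    (h : Move G P Q l) : PartitionBUDStep G k P Q := by
  obtain ⟨v, b, c, hinj, hQ, hQ', hf, hne, hbc, hvb⟩ := h
  have hfib := move_fiber hinj hQ hQ' hf hne
  refine ⟨l, ?_, fun i => P (v i), hinj, fun i => {v i}, fun i => ⟨v i, rfl⟩, ?_, ?_, ?_, ?_, ?_, ?_⟩
  · simpa using Fintype.card_le_of_injective _ hinj
  · rintro i u rfl; rfl
  · intro i
    rw [connected_iff]
    refine ⟨?_, ⟨⟨v i, rfl⟩⟩⟩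
    intro x y
    have : x = y := Subsingleton.elim _ _
    rw [this]
  · intro i
    have e : P ⁻¹' {P (v i)} \ {v i} = {b (i - 1), c (i - 1)} := by
      ext u
      have := hf (i - 1) u
      have h1 := hne (i - 1)
      rw [fin_sub_one_add] at this h1
      simp only [Set.mem_sdiff, Set.mem_preimage, Set.mem_singleton_iff, Set.mem_insert_iff, this]
      constructor
      · tauto
      · rintro (rfl | rfl)
        · exact ⟨by simp, h1.1⟩
        · exact ⟨by simp, h1.2⟩
    rw [e]
    exact induce_pair_connected_of_adj (hbc _)
  · intro i
    exact ⟨v i, rfl, b i, (hf i _).2 (Or.inr (Or.inl rfl)), hvb i⟩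
  · intro i
    refine ⟨P (v (i + 1)), ?_⟩
    ext u
    have h1 := hne i
    simp only [Set.mem_sdiff, Set.mem_preimage, Set.mem_singleton_iff, Set.mem_union, hfib, hf]
    constructor
    · rintro (rfl | rfl | rfl)
      · exact Or.inr rfl
      · exact Or.inl ⟨by simp, h1.1⟩
      · exact Or.inl ⟨by simp, h1.2⟩
    · tauto
  · intro j hj
    refine ⟨j, ?_⟩
    ext u
    simp only [Set.mem_preimage, Set.mem_singleton_iff]
    by_cases hu : ∃ i, u = v i
    · obtain ⟨i, rfl⟩ := hu
      rw [hQ]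
      exact ⟨fun h => absurd ⟨_, h⟩ hj, fun h => absurd ⟨_, h⟩ hj⟩
    · push Not at hu
      rw [hQ' u hu]

/-- One step between tilings, or a relabelling. -/
def PStep {V : Type*} (G : SimpleGraph V) {k : ℕ} (P Q : V → Fin k) : Prop :=
  (PartitionBUDStep G k P Q ∨
    Set.range (fun j : Fin k => P ⁻¹' {j}) = Set.range (fun j : Fin k => Q ⁻¹' {j})) ∧
  Good G P ∧ Good G Q

theorem reach_chain {V : Type*} {G : SimpleGraph V} {k c : ℕ} {P Q : V → Fin k}
    (h : Reach G c P Q) : ∃ n, 2 * n ≤ c ∧ Chn (PStep G) n P Q := by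
  induction h with
  | refl P => exact ⟨0, by simp, Chn.refl P⟩
  | @step P Q R l c a b m _ ih =>
    obtain ⟨n, hn, hc⟩ := ih
    exact ⟨n + 1, by omega, Chn.step ⟨Or.inl (move_step m), a, b⟩ hc⟩

theorem range_eq {V : Type*} {G : SimpleGraph V} {k : ℕ} {P Q : V → Fin k} (hP : Good G P)
    (hQ : Good G Q) (h : ∀ u w, P u = P w ↔ Q u = Q w) :
    Set.range (fun j : Fin k => P ⁻¹' {j}) = Set.range (fun j : Fin k => Q ⁻¹' {j}) := by
  ext s
  constructor
  · rintro ⟨j, rfl⟩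
    obtain ⟨a, _, _, _, _, _, ha⟩ := hP j
    have := (ha a).2 (Or.inl rfl)
    refine ⟨Q a, ?_⟩
    ext u
    simp [← h, this]
  · rintro ⟨j, rfl⟩
    obtain ⟨a, _, _, _, _, _, ha⟩ := hQ j
    have := (ha a).2 (Or.inl rfl)
    refine ⟨P a, ?_⟩
    ext u
    simp [h, this]

theorem part_one {V : Type*} {G : SimpleGraph V} {k : ℕ}
    {f : V → ℕ} (hsw : ∀ P : V → Fin k, Good G P → ∃ Q w, w ≤ 28 * k ∧ Reach G w P Q ∧ Good G Q ∧
      ∀ u w, Q u = Q w ↔ f u = f w) (hk : 0 < k) (P Q : V → Fin k) (hP : Good G P) (hQ : Good G Q) :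
    ∃ s ≤ 30 * k, Chn (PStep G) s P Q := by
  obtain ⟨P1, w1, h1, r1, g1, e1⟩ := hsw P hP
  obtain ⟨Q1, w2, h2, r2, g2, e2⟩ := hsw Q hQ
  obtain ⟨a, ha, ca⟩ := reach_chain r1
  obtain ⟨b, hb, cb⟩ := reach_chain r2.symm
  have hr := range_eq g1 g2 (fun u w => (e1 u w).trans (e2 u w).symm)
  exact ⟨a + (b + 1), by omega, ca.trans (Chn.step ⟨Or.inr hr, g1, g2⟩ cb)⟩


/-! ### Trees -/

/-- The forest of a tiling. -/
def forest {V : Type*} (G : SimpleGraph V) {k : ℕ} (P : V → Fin k) : SimpleGraph V where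
  Adj u w := G.Adj u w ∧ P u = P w
  symm := ⟨fun _ _ h => ⟨h.1.symm, h.2.symm⟩⟩
  loopless := ⟨fun u h => G.loopless.irrefl u h.1⟩

/-- No triangles. -/
def TriFree {V : Type*} (G : SimpleGraph V) : Prop :=
  ∀ a b c, G.Adj a b → G.Adj b c → ¬ G.Adj a c

theorem reach_closed {V : Type*} {H : SimpleGraph V} {s : Set V}
    (hs : ∀ u w, H.Adj u w → u ∈ s → w ∈ s) {u w : V} (h : H.Reachable u w) (hu : u ∈ s) : w ∈ s := by
  obtain ⟨p⟩ := h
  induction p with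
  | nil => exact hu
  | cons a _ ih => exact ih (hs _ _ a hu)

/-- Adjacency in the forest of a tiling. -/
theorem forest_adj {V : Type*} {G : SimpleGraph V} (tri : TriFree G) {k : ℕ} {P : V → Fin k}
    {a b c : V} {i : Fin k}
    (h1 : G.Adj a b) (h2 : G.Adj b c) (h4 : ∀ u, P u = i ↔ u = a ∨ u = b ∨ u = c) {u w : V} (hu : P u = i) :
    (forest G P).Adj u w ↔ (u = a ∧ w = b) ∨ (u = b ∧ w = a) ∨ (u = b ∧ w = c) ∨ (u = c ∧ w = b) := by
  have hac := tri a b c h1 h2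
  have hi : ∀ x, ¬ G.Adj x x := fun x => G.loopless.irrefl x
  constructor
  · rintro ⟨h, h'⟩
    have hw : P w = i := h' ▸ hu
    rw [h4] at hu hw
    rcases hu with rfl | rfl | rfl <;> rcases hw with rfl | rfl | rfl
    · exact absurd h (hi _)
    · simp
    · exact absurd h hac
    · simp
    · exact absurd h (hi _)
    · simp
    · exact absurd h.symm hac
    · simp
    · exact absurd h (hi _)
  · have pa := (h4 a).2 (by simp)
    have pb := (h4 b).2 (by simp)
    have pc := (h4 c).2 (by simp)
    rintro (⟨rfl, rfl⟩ | ⟨rfl, rfl⟩ | ⟨rfl, rfl⟩ | ⟨rfl, rfl⟩)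
    · exact ⟨h1, pa.trans pb.symm⟩
    · exact ⟨h1.symm, pb.trans pa.symm⟩
    · exact ⟨h2, pb.trans pc.symm⟩
    · exact ⟨h2.symm, pc.trans pb.symm⟩

theorem forest_acyclic {V : Type*} {G : SimpleGraph V} (tri : TriFree G) {k : ℕ} {P : V → Fin k}
    (hP : Good G P) : (forest G P).IsAcyclic := by
  rw [isAcyclic_iff_forall_adj_isBridge]
  intro u w huw
  obtain ⟨a, b, c, h1, h2, h3, h4⟩ := hP (P u)
  have key : ∀ x y, P x = P u → (∀ z, (forest G P).Adj x z → z = y) → x ≠ y →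
      (forest G P).IsBridge s(x, y) := by
    intro x y hx hz hxy
    rw [isBridge_iff]
    intro hr
    have := reach_closed (s := {x}) (fun p q hpq hp => ?_) hr rfl
    · exact hxy this.symm
    · rw [Set.mem_singleton_iff] at hp
      subst hp
      rw [deleteEdges_adj] at hpq
      have := hz _ hpq.1
      subst this
      exact absurd rfl hpq.2
  have hab : a ≠ b := h2.ne
  have hcb : c ≠ b := h3.ne'
  have ka := key a b ((h4 a).2 (by simp)) (fun z hz => by
    rw [forest_adj tri h2 h3 h4 ((h4 a).2 (by simp))] at hz
    tauto) hab
  have kc := key c b ((h4 c).2 (by simp)) (fun z hz => by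
    rw [forest_adj tri h2 h3 h4 ((h4 c).2 (by simp))] at hz
    have := h1.symm
    tauto) hcb
  rw [forest_adj tri h2 h3 h4 rfl] at huw
  rcases huw with ⟨rfl, rfl⟩ | ⟨rfl, rfl⟩ | ⟨rfl, rfl⟩ | ⟨rfl, rfl⟩
  · exact ka
  · rw [Sym2.eq_swap]; exact ka
  · rw [Sym2.eq_swap]; exact kc
  · exact kc

theorem forest_reach {V : Type*} {G : SimpleGraph V} {k : ℕ} {P : V → Fin k}
    (hP : Good G P) (u w : V) : (forest G P).Reachable u w ↔ P u = P w := by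
  constructor
  · intro h
    have := reach_closed (s := {x | P u = P x}) (fun p q hpq hp => ?_) h rfl
    · exact this
    · exact Eq.trans hp hpq.2
  · intro h
    obtain ⟨a, b, c, h1, h2, h3, h4⟩ := hP (P u)
    have pa := (h4 a).2 (by simp)
    have pb := (h4 b).2 (by simp)
    have pc := (h4 c).2 (by simp)
    have e1 : (forest G P).Adj a b := ⟨h2, pa.trans pb.symm⟩
    have e2 : (forest G P).Adj b c := ⟨h3, pb.trans pc.symm⟩
    have hb : ∀ x, P x = P u → (forest G P).Reachable b x := by
      intro x hx
      rcases (h4 x).1 hx with rfl | rfl | rfl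
      · exact e1.symm.reachable
      · exact Reachable.refl _
      · exact e2.reachable
    exact (hb u rfl).symm.trans (hb w h.symm)

open Classical in
theorem forest_card {V : Type*} [Fintype V] {G : SimpleGraph V} (tri : TriFree G) {k : ℕ} {P : V → Fin k}
    (hP : Good G P) : (forest G P).edgeFinset.card = 2 * k := by
  have hP' := hP
  choose a b c h1 h2 h3 h4 using hP
  have pa := fun i => (h4 i (a i)).2 (by simp)
  have pb := fun i => (h4 i (b i)).2 (by simp)
  have pc := fun i => (h4 i (c i)).2 (by simp)
  have e : (forest G P).edgeFinset =
      Finset.univ.biUnion (fun i => ({s(a i, b i), s(b i, c i)} : Finset (Sym2 V))) := by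
    ext x
    induction x using Sym2.ind with
    | _ u w =>
    rw [mem_edgeFinset, mem_edgeSet, forest_adj tri (h2 (P u)) (h3 (P u)) (h4 (P u)) rfl]
    simp only [Finset.mem_biUnion, Finset.mem_univ, true_and, Finset.mem_insert,
      Finset.mem_singleton, Sym2.eq_iff]
    constructor
    · intro h
      refine ⟨P u, ?_⟩
      tauto
    · rintro ⟨i, hi⟩
      have : P u = i := by
        rcases hi with (⟨rfl, -⟩ | ⟨rfl, -⟩) | (⟨rfl, -⟩ | ⟨rfl, -⟩)
        · exact pa i
        · exact pb i
        · exact pb i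
        · exact pc i
      subst this
      tauto
  rw [e, Finset.card_biUnion]
  · rw [Finset.sum_congr rfl (g := fun _ => 2)]
    · simp [mul_comm]
    · intro i _
      apply Finset.card_pair
      rw [Ne, Sym2.eq_iff]
      have := h1 i
      have := (h2 i).ne
      tauto
  · intro i _ j _ hij
    rw [Function.onFun, Finset.disjoint_left]
    have hb : ∀ i x, x ∈ ({s(a i, b i), s(b i, c i)} : Finset (Sym2 V)) → b i ∈ x := by
      intro i x hx
      simp only [Finset.mem_insert, Finset.mem_singleton] at hx
      rcases hx with rfl | rfl <;> simp
    have hb' : ∀ i x, x ∈ ({s(a i, b i), s(b i, c i)} : Finset (Sym2 V)) → ∀ y ∈ x, P y = i := by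
      intro i x hx y hy
      simp only [Finset.mem_insert, Finset.mem_singleton] at hx
      rcases hx with rfl | rfl <;> rcases Sym2.mem_iff.1 hy with rfl | rfl
      · exact pa i
      · exact pb i
      · exact pb i
      · exact pc i
    intro x hx hx'
    exact hij ((hb' i x hx _ (hb i x hx)).symm.trans (hb' j x hx' _ (hb i x hx)))

open Classical in
theorem memB_of {V : Type*} [Fintype V] {G : SimpleGraph V} (tri : TriFree G) {k : ℕ} (hk : 0 < k)
    (hV : Fintype.card V = 3 * k) {P : V → Fin k} (hP : Good G P) {T : SimpleGraph V} (hT : T.IsTree)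
    (hTG : T ≤ G) (hF : forest G P ≤ T) : MemB G (fun _ => (1 : ℝ)) k 0 T := by
  refine ⟨hTG, hT, T.edgeFinset \ (forest G P).edgeFinset, ?_⟩
  have hd : T.deleteEdges ((T.edgeFinset \ (forest G P).edgeFinset : Finset (Sym2 V)) : Set (Sym2 V)) =
      forest G P := by
    ext u w
    rw [deleteEdges_adj]
    simp only [Finset.coe_sdiff, coe_edgeFinset, Set.mem_sdiff, mem_edgeSet]
    have := @hF u w
    tauto
  have hsurj : ∀ i, ∃ u, P u = i := by
    intro i
    obtain ⟨a, _, _, _, _, _, ha⟩ := hP i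
    exact ⟨a, (ha a).2 (Or.inl rfl)⟩
  refine ⟨by simp, ?_, ?_⟩
  · rw [Finset.card_sdiff_of_subset (edgeFinset_subset_edgeFinset.2 hF), forest_card tri hP]
    have := hT.card_edgeFinset
    omega
  rw [hd]
  refine ⟨?_, ?_⟩
  · let f : (forest G P).ConnectedComponent → Fin k :=
      Quot.lift P (fun u w h => (forest_reach hP u w).1 h)
    have hf : Function.Bijective f := by
      constructor
      · intro x y
        induction x using ConnectedComponent.ind with | _ x =>
        induction y using ConnectedComponent.ind with | _ y =>
        intro h
        exact ConnectedComponent.sound ((forest_reach hP x y).2 h)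
      · intro i
        obtain ⟨u, hu⟩ := hsurj i
        exact ⟨(forest G P).connectedComponentMk u, hu⟩
    rw [Nat.card_congr (Equiv.ofBijective f hf)]
    simp
  · intro x
    induction x using ConnectedComponent.ind with | _ x =>
    rw [total_div hk hV, compWeight, finsum_one_set]
    have : ((forest G P).connectedComponentMk x).supp = P ⁻¹' {P x} := by
      ext u
      rw [ConnectedComponent.mem_supp_iff, ConnectedComponent.eq, forest_reach hP]
      rfl
    rw [this, hP.ncard]
    norm_num

theorem of_memB {V : Type*} [Fintype V] {G : SimpleGraph V} (tri : TriFree G) {k : ℕ} (hk : 0 < k)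
    (hV : Fintype.card V = 3 * k) {T : SimpleGraph V} (h : MemB G (fun _ => (1 : ℝ)) k 0 T) :
    ∃ P : V → Fin k, Good G P ∧ forest G P ≤ T := by
  obtain ⟨hTG, hT, S, hS, hc, hcc, hw⟩ := h
  generalize hD : T.deleteEdges (S : Set (Sym2 V)) = D at *
  have hDT : D ≤ T := hD ▸ deleteEdges_le _
  have hfin : Finite D.ConnectedComponent := Quot.finite _
  let e : D.ConnectedComponent ≃ Fin k := Finite.equivFinOfCardEq hcc
  let P : V → Fin k := fun u => e (D.connectedComponentMk u)
  have hP : Good D P := by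
    intro i
    have h1 : (e.symm i).supp.ncard = 3 := by
      have := hw (e.symm i)
      rw [total_div hk hV, compWeight, finsum_one_set] at this
      simp only [zero_div, sub_zero, add_zero, Set.Icc_self, Set.mem_singleton_iff] at this
      exact_mod_cast this
    obtain ⟨a, b, c, h1, h2, h3, h4⟩ := path_of_conn (e.symm i).connected_toSimpleGraph h1
    refine ⟨a, b, c, h1, h2, h3, fun u => ?_⟩
    rw [← h4, ConnectedComponent.mem_supp_iff, Equiv.eq_symm_apply]
  have hPG : Good G P := by
    intro i
    obtain ⟨a, b, c, h1, h2, h3, h4⟩ := hP i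
    exact ⟨a, b, c, h1, hTG (hDT h2), hTG (hDT h3), h4⟩
  refine ⟨P, hPG, ?_⟩
  intro u w huw
  obtain ⟨a, b, c, h1, h2, h3, h4⟩ := hP (P u)
  rw [forest_adj tri (hTG (hDT h2)) (hTG (hDT h3)) h4 rfl] at huw
  rcases huw with ⟨rfl, rfl⟩ | ⟨rfl, rfl⟩ | ⟨rfl, rfl⟩ | ⟨rfl, rfl⟩
  · exact hDT h2
  · exact hDT h2.symm
  · exact hDT h3
  · exact hDT h3.symm


/-! ### Edge exchanges -/

open Classical in
theorem exchange {V : Type*} [Fintype V] {G T H : SimpleGraph V} (hT : T.IsTree) (hTG : T ≤ G)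
    {x y : V} (hxy : G.Adj x y) (hH : H.IsAcyclic) (hHT : H ≤ T ⊔ edge x y) :
    ∃ T', T'.IsTree ∧ T' ≤ G ∧ H ≤ T' ∧ (T' = T ∨
      ∃ e ∈ G.edgeSet \ T.edgeSet, ∃ f ∈ (T ⊔ SimpleGraph.fromEdgeSet {e}).edgeSet,
    T' = (T ⊔ SimpleGraph.fromEdgeSet {e}).deleteEdges {f}) := by
  by_cases hadj : T.Adj x y
  · rw [sup_edge_of_adj _ hadj] at hHT
    exact ⟨T, hT, hTG, hHT, Or.inl rfl⟩
  have hU : (T ⊔ edge x y).Connected := hT.connected.mono le_sup_left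
  obtain ⟨T', h1, h2, h3⟩ := hU.exists_isTree_le_of_le_of_isAcyclic hHT hH
  have hUG : T ⊔ edge x y ≤ G := by
    refine sup_le hTG ?_
    intro u w h
    rw [edge_adj] at h
    rcases h.1 with ⟨rfl, rfl⟩ | ⟨rfl, rfl⟩
    · exact hxy
    · exact hxy.symm
  refine ⟨T', h3, h2.trans hUG, h1, Or.inr ⟨s(x, y), ⟨hxy, hadj⟩, ?_⟩⟩
  have hcard : (T ⊔ edge x y).edgeFinset.card = T.edgeFinset.card + 1 := by
    rw [← Finset.card_insert_of_notMem (a := s(x, y)) (by simpa using hadj)]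
    congr 1
    ext e
    induction e using Sym2.ind with | _ u w =>
    simp only [mem_edgeFinset, mem_edgeSet, sup_adj, edge_adj, Finset.mem_insert, Sym2.eq_iff]
    constructor
    · tauto
    · rintro (h | h)
      · refine Or.inr ⟨h, ?_⟩
        rcases h with ⟨rfl, rfl⟩ | ⟨rfl, rfl⟩
        · exact hxy.ne
        · exact hxy.ne'
      · exact Or.inl h
  have hsub : T'.edgeFinset ⊆ (T ⊔ edge x y).edgeFinset := edgeFinset_subset_edgeFinset.2 h2
  have c1 := hT.card_edgeFinset
  have c2 := h3.card_edgeFinset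
  have c3 := Finset.card_sdiff_of_subset hsub
  obtain ⟨f, hf⟩ := Finset.card_eq_one.1 (show ((T ⊔ edge x y).edgeFinset \ T'.edgeFinset).card = 1 by omega)
  have hf' : ∀ e, e = f ↔ e ∈ (T ⊔ edge x y).edgeSet ∧ e ∉ T'.edgeSet := by
    intro e
    have := congrArg (e ∈ ·) hf
    simp only [Finset.mem_sdiff, mem_edgeFinset, Finset.mem_singleton, eq_iff_iff] at this
    exact this.symm
  refine ⟨f, ((hf' f).1 rfl).1, ?_⟩
  ext u w
  rw [deleteEdges_adj, Set.mem_singleton_iff, hf']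
  simp only [mem_edgeSet]
  change _ ↔ (T ⊔ edge x y).Adj u w ∧ _
  have := @h2 u w
  tauto

/-- The tree is a spanning tree containing the forest of a tiling. -/
def Over {V : Type*} (G : SimpleGraph V) {k : ℕ} (P : V → Fin k) (T : SimpleGraph V) : Prop :=
  Good G P ∧ T.IsTree ∧ T ≤ G ∧ forest G P ≤ T

theorem over_step {V : Type*} [Fintype V] {G : SimpleGraph V} (tri : TriFree G) {k : ℕ} (hk : 0 < k)
    (hV : Fintype.card V = 3 * k) {P Q : V → Fin k} {T H : SimpleGraph V} (hT : Over G P T)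
    (hQ : Good G Q) {x y : V} (hxy : G.Adj x y) (hH : H.IsAcyclic) (hHT : H ≤ T ⊔ edge x y)
    (hF : forest G Q ≤ H) : ∃ T', Over G Q T' ∧ H ≤ T' ∧
      ∃ n ≤ 1, Chn (BUDStep G (fun _ => (1 : ℝ)) k 0) n T T' := by
  obtain ⟨hP, h1, h2, h3⟩ := hT
  obtain ⟨T', t1, t2, t3, h⟩ := exchange h1 h2 hxy hH hHT
  refine ⟨T', ⟨hQ, t1, t2, hF.trans t3⟩, t3, ?_⟩
  rcases h with rfl | h
  · exact ⟨0, by simp, Chn.refl _⟩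
  · exact ⟨1, le_rfl, Chn.step ⟨memB_of tri hk hV hP h1 h2 h3, memB_of tri hk hV hQ t1 t2 (hF.trans t3), h⟩
      (Chn.refl _)⟩

theorem move_lift {V : Type*} [Fintype V] {G : SimpleGraph V} (tri : TriFree G) {k l : ℕ} (hk : 0 < k)
    (hV : Fintype.card V = 3 * k) {P Q : V → Fin k} {T : SimpleGraph V} (hT : Over G P T)
    (hm : Move G P Q l) : ∃ T', Over G Q T' ∧
      ∃ n ≤ l + 2, Chn (BUDStep G (fun _ => (1 : ℝ)) k 0) n T T' := by
  have hP := hT.1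
  have hQ := move_good hP hm
  obtain ⟨v, b, c, hinj, hQ1, hQ', hf, hne, hbc, hvb⟩ := hm
  have hfib := move_fiber hinj hQ1 hQ' hf hne
  have pb : ∀ i, P (b i) = P (v (i + 1)) := fun i => (hf i _).2 (Or.inr (Or.inl rfl))
  have pc : ∀ i, P (c i) = P (v (i + 1)) := fun i => (hf i _).2 (Or.inr (Or.inr rfl))
  have main : ∀ j : ℕ, j ≤ l + 1 → ∃ A : SimpleGraph V, A.IsAcyclic ∧ forest G P ≤ A ∧
      (∀ i : Fin (l + 2), i.val < j → A.Adj (v i) (b i)) ∧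
      (∀ u w, A.Adj u w → P u = P w ∨ ∃ i : Fin (l + 2), i.val < j ∧
        ((u = v i ∧ w = b i) ∨ (u = b i ∧ w = v i))) ∧
      ∃ T', Over G P T' ∧ A ≤ T' ∧ ∃ n ≤ j, Chn (BUDStep G (fun _ => (1 : ℝ)) k 0) n T T' := by
    intro j
    induction j with
    | zero =>
      intro _
      exact ⟨forest G P, forest_acyclic tri hP, le_rfl, by simp, fun u w h => Or.inl h.2,
        T, hT, hT.2.2.2, 0, le_rfl, Chn.refl _⟩
    | succ j ih =>
      intro hj
      obtain ⟨A, a1, a2, a3, a4, T1, t1, t2, n, hn, hch⟩ := ih (by omega)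
      let i : Fin (l + 2) := ⟨j, by omega⟩
      have hi1 : ((i + 1 : Fin (l + 2)) : ℕ) = j + 1 := by
        rw [Fin.val_add_one_of_lt']
        show j + 1 < l + 2
        omega
      have hnr : ¬ A.Reachable (v i) (b i) := by
        intro hr
        have := reach_closed (s := {u | P u ≠ P (v (i + 1))}) (fun p q hpq hp => ?_) hr ?_
        · exact this (pb i)
        · rcases a4 p q hpq with h | ⟨i', hi', ⟨rfl, rfl⟩ | ⟨rfl, rfl⟩⟩
          · show P q ≠ _
            rw [← h]; exact hp
          · intro h
            rw [pb] at h
            have h' := add_right_cancel (hinj h)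
            rw [h'] at hi'
            exact absurd hi' (lt_irrefl j)
          · intro h
            have h' := hinj h
            rw [h', hi1] at hi'
            omega
        · intro h
          have h' := congrArg Fin.val (hinj h)
          rw [hi1] at h'
          exact absurd h' (Nat.lt_succ_self j).ne
      have hA := a1.sup_edge_of_not_reachable hnr
      obtain ⟨T2, s1, s2, n2, hn2, hch2⟩ := over_step tri hk hV t1 hP (hvb i) hA
        (sup_le_sup_right t2 _) (a2.trans le_sup_left)
      refine ⟨_, hA, a2.trans le_sup_left, ?_, ?_, T2, s1, s2, n + n2, by omega, hch.trans hch2⟩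
      · intro i' hi'
        by_cases h : i'.val < j
        · exact Or.inl (a3 i' h)
        · have : i' = i := Fin.ext (by show _ = j; omega)
          subst this
          refine Or.inr ?_
          rw [edge_adj]
          exact ⟨Or.inl ⟨rfl, rfl⟩, (hvb _).ne⟩
      · intro u w h
        rcases h with h | h
        · rcases a4 u w h with h | ⟨i', hi', h⟩
          · exact Or.inl h
          · exact Or.inr ⟨i', by omega, h⟩
        · rw [edge_adj] at h
          exact Or.inr ⟨i, Nat.lt_succ_self j, h.1⟩
  obtain ⟨A, a1, a2, a3, a4, T1, t1, t2, n, hn, hch⟩ := main (l + 1) le_rfl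
  have hle : forest G Q ≤ T1 ⊔ edge (v (Fin.last _)) (b (Fin.last _)) := by
    intro u w h
    by_cases hu : ∃ i, Q u = P (v (i + 1))
    · obtain ⟨i, hi⟩ := hu
      have hvbi : (T1 ⊔ edge (v (Fin.last _)) (b (Fin.last _))).Adj (v i) (b i) := by
        by_cases h : i.val < l + 1
        · exact Or.inl (t2 (a3 i h))
        · have : i = Fin.last _ := Fin.ext (by have := i.2; simp; omega)
          subst this
          refine Or.inr ?_
          rw [edge_adj]
          exact ⟨Or.inl ⟨rfl, rfl⟩, (hvb _).ne⟩
      have hbci : (T1 ⊔ edge (v (Fin.last _)) (b (Fin.last _))).Adj (b i) (c i) :=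
        Or.inl (t2 (a2 ⟨hbc i, (pb i).trans (pc i).symm⟩))
      rw [forest_adj tri (hvb i) (hbc i) (hfib i) hi] at h
      rcases h with ⟨rfl, rfl⟩ | ⟨rfl, rfl⟩ | ⟨rfl, rfl⟩ | ⟨rfl, rfl⟩
      · exact hvbi
      · exact hvbi.symm
      · exact hbci
      · exact hbci.symm
    · push Not at hu
      have key : ∀ x, Q x = Q u → P x = Q u := by
        intro x hx
        rw [← hx]
        refine (hQ' x fun i hi => hu i ?_).symm
        rw [← hx, hi, hQ1]
      exact Or.inl (t2 (a2 ⟨h.1, (key u rfl).trans (key w h.2.symm).symm⟩))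
  obtain ⟨T2, s1, -, n2, hn2, hch2⟩ := over_step tri hk hV t1 hQ (hvb (Fin.last _))
    (forest_acyclic tri hQ) hle le_rfl
  exact ⟨T2, s1, n + n2, by omega, hch.trans hch2⟩

theorem reach_lift {V : Type*} [Fintype V] {G : SimpleGraph V} (tri : TriFree G) {k w : ℕ} (hk : 0 < k)
    (hV : Fintype.card V = 3 * k) {P Q : V → Fin k} (hr : Reach G w P Q) :
    ∀ T : SimpleGraph V, Over G P T → ∃ T', Over G Q T' ∧
      ∃ n ≤ w, Chn (BUDStep G (fun _ => (1 : ℝ)) k 0) n T T' := by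
  induction hr with
  | refl P => exact fun T hT => ⟨T, hT, 0, le_rfl, Chn.refl _⟩
  | @step P Q R l c a b m _ ih =>
    intro T hT
    obtain ⟨T1, h1, n1, hn1, c1⟩ := move_lift tri hk hV hT m
    obtain ⟨T2, h2, n2, hn2, c2⟩ := ih T1 h1
    exact ⟨T2, h2, n1 + n2, by omega, c1.trans c2⟩

open Classical in
theorem same_lift {V : Type*} [Fintype V] {G : SimpleGraph V} (tri : TriFree G) {k : ℕ} (hk : 0 < k)
    (hV : Fintype.card V = 3 * k) {P : V → Fin k} {T' : SimpleGraph V} (hT' : Over G P T') (d : ℕ) :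
    ∀ T : SimpleGraph V, Over G P T → (T'.edgeFinset \ T.edgeFinset).card ≤ d →
      ∃ n ≤ d, Chn (BUDStep G (fun _ => (1 : ℝ)) k 0) n T T' := by
  induction d with
  | zero =>
    intro T hT hd
    have h0 : T'.edgeFinset ⊆ T.edgeFinset := by
      rw [← Finset.sdiff_eq_empty_iff_subset, ← Finset.card_eq_zero]; omega
    have : T'.edgeFinset = T.edgeFinset := Finset.eq_of_subset_of_card_le h0 (by
      have := hT.2.1.card_edgeFinset
      have := hT'.2.1.card_edgeFinset
      omega)
    have := edgeFinset_inj.1 this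
    subst this
    exact ⟨0, le_rfl, Chn.refl _⟩
  | succ d ih =>
    intro T hT hd
    by_cases hz : (T'.edgeFinset \ T.edgeFinset).card ≤ d
    · obtain ⟨n, hn, hc⟩ := ih T hT hz
      exact ⟨n, by omega, hc⟩
    obtain ⟨e, he⟩ : (T'.edgeFinset \ T.edgeFinset).Nonempty := by
      rw [← Finset.card_pos]; omega
    induction e using Sym2.ind with | _ x y =>
    have he' : T'.Adj x y ∧ ¬ T.Adj x y := by simpa using he
    have hle : T ⊓ T' ⊔ edge x y ≤ T' := by
      refine sup_le inf_le_right ?_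
      intro u w h
      rw [edge_adj] at h
      rcases h.1 with ⟨rfl, rfl⟩ | ⟨rfl, rfl⟩
      · exact he'.1
      · exact he'.1.symm
    obtain ⟨T1, h1, h2, n1, hn1, c1⟩ := over_step tri hk hV hT hT.1 (hT'.2.2.1 he'.1)
      (hT'.2.1.isAcyclic.anti hle) (sup_le_sup_right inf_le_left _)
      ((le_inf hT.2.2.2 hT'.2.2.2).trans le_sup_left)
    have hlt : (T'.edgeFinset \ T1.edgeFinset) ⊂ (T'.edgeFinset \ T.edgeFinset) := by
      rw [Finset.ssubset_iff_of_subset]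
      · refine ⟨s(x, y), he, ?_⟩
        have : T1.Adj x y := h2 (Or.inr (by rw [edge_adj]; exact ⟨Or.inl ⟨rfl, rfl⟩, he'.1.ne⟩))
        simp [this]
      · intro f hf
        induction f using Sym2.ind with | _ u w =>
        simp only [Finset.mem_sdiff, mem_edgeFinset, mem_edgeSet] at hf ⊢
        exact ⟨hf.1, fun h => hf.2 (h2 (Or.inl ⟨h, hf.1⟩))⟩
    have := Finset.card_lt_card hlt
    obtain ⟨n2, hn2, c2⟩ := ih T1 h1 (by omega)
    exact ⟨n1 + n2, by omega, c1.trans c2⟩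

theorem part_two {V : Type*} [Fintype V] {G : SimpleGraph V} (tri : TriFree G) {k : ℕ}
    (hV : Fintype.card V = 3 * k)
    {f : V → ℕ} (hsw : ∀ P : V → Fin k, Good G P → ∃ Q w, w ≤ 28 * k ∧ Reach G w P Q ∧ Good G Q ∧
      ∀ u w, Q u = Q w ↔ f u = f w) (hk : 0 < k) (T T' : SimpleGraph V)
    (hT : MemB G (fun _ => (1 : ℝ)) k 0 T) (hT' : MemB G (fun _ => (1 : ℝ)) k 0 T') :
    ∃ s ≤ 61 * k, Chn (BUDStep G (fun _ => (1 : ℝ)) k 0) s T T' := by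
  classical
  obtain ⟨P, hP, hF⟩ := of_memB tri hk hV hT
  obtain ⟨Q, hQ, hF'⟩ := of_memB tri hk hV hT'
  have oQ : Over G Q T' := ⟨hQ, hT'.2.1, hT'.1, hF'⟩
  obtain ⟨P1, w1, h1, r1, g1, e1⟩ := hsw P hP
  obtain ⟨Q1, w2, h2, r2, g2, e2⟩ := hsw Q hQ
  obtain ⟨T1, o1, n1, hn1, c1⟩ := reach_lift tri hk hV r1 T ⟨hP, hT.2.1, hT.1, hF⟩
  have o1' : Over G Q1 T1 := by
    refine ⟨g2, o1.2.1, o1.2.2.1, ?_⟩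
    intro u w h
    exact o1.2.2.2 ⟨h.1, (e1 u w).2 ((e2 u w).1 h.2)⟩
  obtain ⟨T2, o2, n2, hn2, c2⟩ := reach_lift tri hk hV r2.symm T1 o1'
  have hd : (T'.edgeFinset \ T2.edgeFinset).card ≤ k := by
    have s1 : T'.edgeFinset \ T2.edgeFinset ⊆ T'.edgeFinset \ (forest G Q).edgeFinset :=
      Finset.sdiff_subset_sdiff le_rfl (edgeFinset_subset_edgeFinset.2 o2.2.2.2)
    have := Finset.card_le_card s1
    rw [Finset.card_sdiff_of_subset (edgeFinset_subset_edgeFinset.2 hF'), forest_card tri hQ] at this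
    have := hT'.2.1.card_edgeFinset
    omega
  obtain ⟨n3, hn3, c3⟩ := same_lift tri hk hV oQ k T2 o2 hd
  exact ⟨n1 + n2 + n3, by omega, (c1.trans c2).trans c3⟩


/-! ### Assembly -/

theorem sq_add_one (x y : ℤ) : x ^ 2 + y ^ 2 = 1 ↔
    (x = 0 ∧ (y = 1 ∨ y = -1)) ∨ (y = 0 ∧ (x = 1 ∨ x = -1)) := by
  constructor
  · intro h
    have hx1 : x ≤ 1 := by nlinarith [sq_nonneg y]
    have hx2 : -1 ≤ x := by nlinarith [sq_nonneg y]
    have hy1 : y ≤ 1 := by nlinarith [sq_nonneg x]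
    have hy2 : -1 ≤ y := by nlinarith [sq_nonneg x]
    interval_cases x <;> interval_cases y <;> simp_all
  · rintro (⟨rfl, rfl | rfl⟩ | ⟨rfl, rfl | rfl⟩) <;> norm_num

theorem rectGrid_adj {m n : ℕ} (u v : Fin m × Fin n) : (rectGrid m n).Adj u v ↔
    ((u.1 : ℕ) = v.1 ∧ ((u.2 : ℕ) = v.2 + 1 ∨ (v.2 : ℕ) = u.2 + 1)) ∨
    ((u.2 : ℕ) = v.2 ∧ ((u.1 : ℕ) = v.1 + 1 ∨ (v.1 : ℕ) = u.1 + 1)) := by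
  unfold rectGrid
  rw [fromRel_adj, sq_add_one, sq_add_one]
  obtain ⟨⟨a, ha⟩, ⟨b, hb⟩⟩ := u
  obtain ⟨⟨c, hc⟩, ⟨d, hd⟩⟩ := v
  simp only [ne_eq, Prod.mk.injEq, Fin.mk.injEq]
  omega

theorem rectGrid_tri (m n : ℕ) : TriFree (rectGrid m n) := by
  intro a b c
  rw [rectGrid_adj, rectGrid_adj, rectGrid_adj]
  omega

theorem grid_row (m q : ℕ) : Grid (rectGrid m (3 * q)) (fun v => (v.1 : ℕ)) (fun v => (v.2 : ℕ)) m q where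
  hR v := v.1.2
  hC v := v.2.2
  surj r c hr hc := ⟨(⟨r, hr⟩, ⟨c, hc⟩), rfl, rfl⟩
  inj _ _ h1 h2 := Prod.ext (Fin.ext h1) (Fin.ext h2)
  adj u v := rectGrid_adj u v

theorem grid_col (q n : ℕ) : Grid (rectGrid (3 * q) n) (fun v => (v.2 : ℕ)) (fun v => (v.1 : ℕ)) n q where
  hR v := v.2.2
  hC v := v.1.2
  surj r c hr hc := ⟨(⟨c, hc⟩, ⟨r, hr⟩), rfl, rfl⟩
  inj _ _ h1 h2 := Prod.ext (Fin.ext h2) (Fin.ext h1)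
  adj u v := by rw [rectGrid_adj]; exact or_comm

theorem sweep_rect (m n k : ℕ) (h : m * n = 3 * k) : ∃ f : Fin m × Fin n → ℕ,
    ∀ P : Fin m × Fin n → Fin k, Good (rectGrid m n) P → ∃ Q w, w ≤ 28 * k ∧
      Reach (rectGrid m n) w P Q ∧ Good (rectGrid m n) Q ∧ ∀ u w, Q u = Q w ↔ f u = f w := by
  have h3 : 3 ∣ m * n := ⟨k, h⟩
  rcases (Nat.Prime.dvd_mul Nat.prime_three).1 h3 with ⟨q, rfl⟩ | ⟨q, rfl⟩
  · have hk : n * q = k := by nlinarith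
    refine ⟨fun v => (v.2 : ℕ) * q + (v.1 : ℕ) / 3, fun P hP => ?_⟩
    subst hk
    exact sweep_all (grid_col q n) hP
  · have hk : m * q = k := by nlinarith
    refine ⟨fun v => (v.1 : ℕ) * q + (v.2 : ℕ) / 3, fun P hP => ?_⟩
    subst hk
    exact sweep_all (grid_row m q) hP

/-- Triomino irreducibility on rectangular grids: if the `m × n` grid (with
`N = mn`, `3 ∣ N`, `k = N/3`, unit weights) admits a triomino tiling, then
(1) any two triomino tilings are connected by at most `10N` BUD steps on
partitions, and (2) any two trees in `B^0_{N/3}(G)` are connected by at most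
`(61/3)·N` up–down edge-exchange steps through trees in `B^0_{N/3}(G)`. -/
theorem stmt10 (m n : ℕ) (hm : 0 < m) (hn : 0 < n)
    (N : ℕ) (hN : N = m * n) (h3 : 3 ∣ N) (k : ℕ) (hk : k = N / 3)
    (hex : ∃ P : Fin m × Fin n → Fin k,
      IsBalancedPartition (rectGrid m n) (fun _ => (1 : ℝ)) k P) :
    (∀ P Q : Fin m × Fin n → Fin k,
      IsBalancedPartition (rectGrid m n) (fun _ => (1 : ℝ)) k P →
      IsBalancedPartition (rectGrid m n) (fun _ => (1 : ℝ)) k Q →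
      ∃ s ≤ 10 * N, ∃ c : ℕ → (Fin m × Fin n → Fin k), c 0 = P ∧ c s = Q ∧
        (∀ i ≤ s, IsBalancedPartition (rectGrid m n) (fun _ => (1 : ℝ)) k (c i)) ∧
        (∀ i < s, PartitionBUDStep (rectGrid m n) k (c i) (c (i + 1)) ∨
          Set.range (fun j : Fin k => (c i) ⁻¹' {j}) =
            Set.range (fun j : Fin k => (c (i + 1)) ⁻¹' {j}))) ∧
    (∀ T T' : SimpleGraph (Fin m × Fin n),
      MemB (rectGrid m n) (fun _ => (1 : ℝ)) k 0 T →
      MemB (rectGrid m n) (fun _ => (1 : ℝ)) k 0 T' →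
      ∃ s : ℕ, (s : ℝ) ≤ 61 / 3 * N ∧ ∃ c : ℕ → SimpleGraph (Fin m × Fin n),
        c 0 = T ∧ c s = T' ∧
        ∀ i < s, BUDStep (rectGrid m n) (fun _ => (1 : ℝ)) k 0 (c i) (c (i + 1))) := by
  subst hN
  have hmn : m * n = 3 * k := by omega
  have hV : Fintype.card (Fin m × Fin n) = 3 * k := by simpa using hmn
  have hk0 : 0 < k := by
    have := Nat.mul_pos hm hn
    omega
  obtain ⟨f, hf⟩ := sweep_rect m n k hmn
  refine ⟨fun P Q hP hQ => ?_, fun T T' hT hT' => ?_⟩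
  · rw [balanced_iff hV] at hP hQ
    obtain ⟨s, hs, hc⟩ := part_one hf hk0 P Q hP hQ
    obtain ⟨c, h0, h1, h2⟩ := hc.exists_fun
    refine ⟨s, by omega, c, h0, h1, fun i hi => ?_, fun i hi => (h2 i hi).1⟩
    rw [balanced_iff hV]
    rcases hi.lt_or_eq with hi | rfl
    · exact (h2 i hi).2.1
    · rw [h1]; exact hQ
  · obtain ⟨s, hs, hc⟩ := part_two (rectGrid_tri m n) hV hf hk0 T T' hT hT'
    obtain ⟨c, h0, h1, h2⟩ := hc.exists_fun
    refine ⟨s, ?_, c, h0, h1, h2⟩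
    have e1 : (s : ℝ) ≤ 61 * k := by exact_mod_cast hs
    have e2 : ((m * n : ℕ) : ℝ) = 3 * k := by exact_mod_cast hmn
    rw [e2]
    linarith
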